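/- For every θ ≥ 2 and every choice of constants in the Harnack assumptions there exist C, c > 0 such that: for every Markov kernel (Γ,K,π) satisfying the Harnack assumptions with parameter θ and those constants, every x ∈ V, every real R ≥ 0 and every integer s ≥ 1, the chain (X_n) driven by K with X_0 = x satisfies P_x( d(x, X_s) > R ) ≤ C · exp( − c · (R^θ / s)^{1/(θ−1)} ). -/

import Mathlib

open Finset
open scoped Classical

variable {V : Type*} [Fintype V] [DecidableEq V]

/-- `matpow K n` is the `n`-th matrix power of the kernel `K`. -/
noncomputable def matpow (K : V → V → ℝ) : ℕ → V → V → ℝ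
  | 0 => fun x y => if x = y then (1 : ℝ) else 0
  | n + 1 => fun x y => ∑ z, K x z * matpow K n z y

/-- `(Γ, K, π)` is a Markov kernel: `G` is a connected (simple) graph on the finite vertex
set `V`, `K` is a stochastic kernel, irreducible, reversible with respect to the probability
measure `pi`, positive on edges and vanishing off edges (apart from the diagonal). -/
def IsMarkovKernel (G : SimpleGraph V) (K : V → V → ℝ) (pi : V → ℝ) : Prop :=
  G.Connected ∧
  (∀ x y, 0 ≤ K x y) ∧ (∀ x, ∑ y, K x y = 1) ∧
  (∀ x, 0 < pi x) ∧ (∑ x, pi x = 1) ∧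
  (∀ x y, pi x * K x y = pi y * K y x) ∧
  (∀ x y, G.Adj x y → 0 < K x y) ∧
  (∀ x y, x ≠ y → ¬ G.Adj x y → K x y = 0) ∧
  (∀ x y, ∃ n, 0 < matpow K n x y)

/-- Aperiodicity of an irreducible finite kernel, via primitivity. -/
def Aperiodic (K : V → V → ℝ) : Prop :=
  ∃ N : ℕ, ∀ n ≥ N, ∀ x y, 0 < matpow K n x y

/-- `K` is lazy if `K(x,x) ≥ 1/2` for all `x`. -/
def Lazy (K : V → V → ℝ) : Prop := ∀ x, (1 : ℝ) / 2 ≤ K x x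

/-- The closed ball `B(x,r)` for the graph distance. -/
noncomputable def gball (G : SimpleGraph V) (x : V) (r : ℝ) : Finset V :=
  univ.filter fun y => (G.dist x y : ℝ) ≤ r

/-- The volume `V(x,r) = π(B(x,r))`. -/
noncomputable def vol (G : SimpleGraph V) (pi : V → ℝ) (x : V) (r : ℝ) : ℝ :=
  ∑ y ∈ gball G x r, pi y

/-- The diameter of the graph `G`. -/
noncomputable def gdiam (G : SimpleGraph V) : ℕ :=
  univ.sup fun x => univ.sup fun y => G.dist x y

/-- The normalized kernel `k^n(x,y) = K^n(x,y)/π(y)`. -/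
noncomputable def knorm (K : V → V → ℝ) (pi : V → ℝ) (n : ℕ) (x y : V) : ℝ :=
  matpow K n x y / pi y

/-- The normalized Green function `𝒢(x,y) = ∑_{n≥0} (k^n(x,y) - 1)`. -/
noncomputable def green (K : V → V → ℝ) (pi : V → ℝ) (x y : V) : ℝ :=
  ∑' n : ℕ, (knorm K pi n x y - 1)

/-- `avoid K y n x = P_x(X_0 ≠ y, …, X_n ≠ y) = P_x(τ_y > n)`. -/
noncomputable def avoid (K : V → V → ℝ) (y : V) : ℕ → V → ℝ
  | 0 => fun x => if x = y then 0 else 1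
  | n + 1 => fun x => if x = y then 0 else ∑ z, K x z * avoid K y n z

/-- The expected hitting time `H(x,y) = E_x[τ_y] = ∑_{n≥0} P_x(τ_y > n)`. -/
noncomputable def hit (K : V → V → ℝ) (x y : V) : ℝ := ∑' n : ℕ, avoid K y n x

/-- `P_x(d(x, X_s) > R)` for the chain driven by `K` started at `x`. -/
noncomputable def probGt (G : SimpleGraph V) (K : V → V → ℝ) (x : V) (s : ℕ) (R : ℝ) : ℝ :=
  ∑ y ∈ univ.filter (fun y => R < (G.dist x y : ℝ)), matpow K s x y

/-- The probability that the chain driven by `K`, started at `x`, produces a trajectory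
`(X_0, …, X_t)` belonging to the event `A`. -/
noncomputable def pathProb (K : V → V → ℝ) (x : V) (t : ℕ)
    (A : (Fin (t + 1) → V) → Prop) : ℝ :=
  ∑ p ∈ univ.filter (fun p : Fin (t + 1) → V => p 0 = x ∧ A p),
    ∏ i : Fin t, K (p i.castSucc) (p i.succ)

/-- Condition (E): ellipticity with constant `p0`. -/
def CondE (G : SimpleGraph V) (K : V → V → ℝ) (p0 : ℝ) : Prop :=
  ∀ x y, G.Adj x y → p0 ≤ K x y

/-- Condition (VD): volume doubling with constant `CD`. -/
def CondVD (G : SimpleGraph V) (pi : V → ℝ) (CD : ℝ) : Prop :=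
  ∀ x : V, ∀ r : ℝ, 0 < r → vol G pi x (2 * r) ≤ CD * vol G pi x r

/-- The `π`-average of `f` over the ball `B(x,r)`. -/
noncomputable def ballAvg (G : SimpleGraph V) (pi : V → ℝ) (x : V) (r : ℝ) (f : V → ℝ) : ℝ :=
  (vol G pi x r)⁻¹ * ∑ z ∈ gball G x r, f z * pi z

/-- Condition (PI(θ)): Poincaré inequality with constant `CP`. -/
def CondPI (G : SimpleGraph V) (K : V → V → ℝ) (pi : V → ℝ) (θ CP : ℝ) : Prop :=
  ∀ x : V, ∀ r : ℝ, 0 < r → ∀ f : V → ℝ,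
    (∑ z ∈ gball G x r, |f z - ballAvg G pi x r f| ^ 2 * pi z) ≤
      CP * r ^ θ * ∑ ξ ∈ gball G x r, ∑ ζ ∈ gball G x r,
        if G.Adj ξ ζ then |f ξ - f ζ| ^ 2 * K ξ ζ * pi ξ else 0

/-- Condition (CS(θ)): existence of cut-off functions. -/
def CondCS (G : SimpleGraph V) (K : V → V → ℝ) (pi : V → ℝ) (θ C1 C2 ε : ℝ) : Prop :=
  ∀ x : V, ∀ r : ℝ, 0 < r → ∃ σ : V → ℝ,
    (∀ y ∈ gball G x (r / 2), 1 ≤ σ y) ∧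
    (∀ y, y ∉ gball G x r → σ y = 0) ∧
    (∀ z y, |σ z - σ y| ≤ C1 * ((G.dist z y : ℝ) / r) ^ ε) ∧
    (∀ s : ℝ, 0 < s → s ≤ r → ∀ f : V → ℝ,
      (∑ z ∈ gball G x s, |f z| ^ 2 *
          ∑ y, (if G.Adj z y then |σ z - σ y| ^ 2 * K z y * pi z else 0)) ≤
        C2 * (s / r) ^ (2 * ε) *
          ((∑ z ∈ gball G x (2 * s), ∑ y ∈ gball G x (2 * s),
              if G.Adj z y then |f z - f y| ^ 2 * K z y * pi z else 0) +
            s ^ (-θ) * ∑ z ∈ gball G x (2 * s), |f z| ^ 2 * pi z))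

/-- The Harnack assumptions (E), (VD), (PI(θ)), (CS(θ)) with the given constants. -/
def Harnack (G : SimpleGraph V) (K : V → V → ℝ) (pi : V → ℝ)
    (θ p0 CD CP Ccs1 Ccs2 ε : ℝ) : Prop :=
  0 < p0 ∧ 0 < CD ∧ 0 < CP ∧ 0 < Ccs1 ∧ 0 < Ccs2 ∧ 0 < ε ∧
  CondE G K p0 ∧ CondVD G pi CD ∧ CondPI G K pi θ CP ∧ CondCS G K pi θ Ccs1 Ccs2 ε


set_option linter.unusedSectionVars false

/-- The part of the Markov kernel assumptions used below. -/
structure MK (G : SimpleGraph V) (K : V → V → ℝ) (pi : V → ℝ) : Prop where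
  conn : G.Connected
  nn : ∀ x y, 0 ≤ K x y
  sum1 : ∀ x, ∑ y, K x y = 1
  pos : ∀ x, 0 < pi x
  rev : ∀ x y, pi x * K x y = pi y * K y x
  off : ∀ x y, x ≠ y → ¬ G.Adj x y → K x y = 0

/-- Energy of `f` on the finite set `S`. -/
noncomputable def en (K : V → V → ℝ) (pi : V → ℝ) (S : Finset V) (f : V → ℝ) : ℝ :=
  ∑ z ∈ S, ∑ y ∈ S, (f z - f y) ^ 2 * K z y * pi z

theorem MK.ite {G : SimpleGraph V} {K : V → V → ℝ} {pi : V → ℝ} (h : MK G K pi)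
    (g : V → ℝ) (z y : V) :
    (if G.Adj z y then |g z - g y| ^ 2 * K z y * pi z else 0)
      = (g z - g y) ^ 2 * K z y * pi z := by
  split_ifs with ha
  · rw [sq_abs]
  · by_cases hzy : z = y
    · subst hzy; simp
    · rw [h.off z y hzy ha]; simp

theorem MK.tri {G : SimpleGraph V} {K : V → V → ℝ} {pi : V → ℝ} (h : MK G K pi) (x y z : V) :
    (G.dist x z : ℝ) ≤ G.dist x y + G.dist y z := by
  exact_mod_cast h.conn.dist_triangle

theorem MK.step {G : SimpleGraph V} {K : V → V → ℝ} {pi : V → ℝ} (h : MK G K pi) {x y : V}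
    (hK : K x y ≠ 0) : (G.dist x y : ℝ) ≤ 1 := by
  by_cases hxy : x = y
  · subst hxy; simp
  · have ha : G.Adj x y := by
      by_contra ha
      exact hK (h.off x y hxy ha)
    rw [SimpleGraph.dist_eq_one_iff_adj.mpr ha]; simp

theorem mem_gball' {G : SimpleGraph V} {x y : V} {r : ℝ} :
    y ∈ gball G x r ↔ (G.dist x y : ℝ) ≤ r := by
  simp [gball]

theorem MK.sdist {G : SimpleGraph V} (x y : V) : (G.dist x y : ℝ) = G.dist y x := by
  rw [SimpleGraph.dist_comm]

/-- Maximum principle. -/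
theorem MK.maxp {G : SimpleGraph V} {K : V → V → ℝ} {pi : V → ℝ} (h : MK G K pi) {l : ℝ}
    (hl : 0 < l) (U N : Finset V) (g : V → ℝ)
    (hU : ∀ z ∈ U, (1 + l) * g z ≤ ∑ y, K z y * g y)
    (hN : ∀ z ∈ U, ∀ y, K z y ≠ 0 → y ∈ N)
    (hb : ∀ z ∈ N, z ∉ U → g z ≤ 0) : ∀ z ∈ N, g z ≤ 0 := by
  intro z hz
  by_contra hgz
  push Not at hgz
  obtain ⟨m, hm, hmax⟩ := N.exists_max_image g ⟨z, hz⟩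
  have hpos : 0 < g m := lt_of_lt_of_le hgz (hmax z hz)
  have hmU : m ∈ U := by
    by_contra hmU
    exact absurd (hb m hm hmU) (not_le.mpr hpos)
  have h1 := hU m hmU
  have h2 : ∑ y, K m y * g y ≤ ∑ y, K m y * g m := by
    apply Finset.sum_le_sum
    intro y _
    by_cases hk : K m y = 0
    · simp [hk]
    · exact mul_le_mul_of_nonneg_left (hmax y (hN m hmU y hk)) (h.nn m y)
  rw [← Finset.sum_mul, h.sum1, one_mul] at h2
  nlinarith

/-- Solvability of the discrete Dirichlet problem with discount. -/
theorem MK.solve {G : SimpleGraph V} {K : V → V → ℝ} {pi : V → ℝ} (h : MK G K pi) {l : ℝ}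
    (hl : 0 < l) (U : Finset V) (b : V → ℝ) :
    ∃ v : V → ℝ, (∀ z ∈ U, (1 + l) * v z = ∑ y, K z y * v y + b z) ∧
      (∀ z, z ∉ U → v z = b z) := by
  let T : (V → ℝ) →ₗ[ℝ] (V → ℝ) :=
    { toFun := fun f z => if z ∈ U then (1 + l) * f z - ∑ y, K z y * f y else f z
      map_add' := by
        intro f g; funext z
        by_cases hz : z ∈ U
        · simp only [hz, if_true, Pi.add_apply, mul_add, Finset.sum_add_distrib]; ring
        · simp [hz]
      map_smul' := by
        intro c f; funext z
        by_cases hz : z ∈ U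
        · simp only [hz, if_true, Pi.smul_apply, smul_eq_mul, RingHom.id_apply, mul_sub,
            Finset.mul_sum]
          congr 1
          · ring
          · apply Finset.sum_congr rfl; intros; ring
        · simp [hz] }
  have key : ∀ f : V → ℝ, T f = 0 → ∀ z, f z ≤ 0 := by
    intro f hf z
    refine h.maxp hl U univ f ?_ (by simp) ?_ z (mem_univ z)
    · intro z hz
      have := congrFun hf z
      simp only [T, LinearMap.coe_mk, AddHom.coe_mk, hz, if_true, Pi.zero_apply] at this
      linarith
    · intro z _ hz
      have := congrFun hf z
      simp only [T, LinearMap.coe_mk, AddHom.coe_mk, hz, if_false, Pi.zero_apply] at this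
      linarith
  have hinj : Function.Injective T := by
    rw [← LinearMap.ker_eq_bot, LinearMap.ker_eq_bot']
    intro f hf
    funext z
    have h1 := key f hf z
    have h2 := key (-f) (by rw [map_neg, hf, neg_zero]) z
    simp only [Pi.neg_apply] at h2
    simp only [Pi.zero_apply]
    linarith
  obtain ⟨v, hv⟩ := LinearMap.injective_iff_surjective.mp hinj b
  refine ⟨v, ?_, ?_⟩
  · intro z hz
    have := congrFun hv z
    simp only [T, LinearMap.coe_mk, AddHom.coe_mk, hz, if_true] at this
    linarith
  · intro z hz
    have := congrFun hv z
    simp only [T, LinearMap.coe_mk, AddHom.coe_mk, hz, if_false] at this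
    exact this

theorem vol_mono {G : SimpleGraph V} {K : V → V → ℝ} {pi : V → ℝ} (h : MK G K pi) {x y : V}
    {r r' : ℝ} (hr : (G.dist y x : ℝ) + r ≤ r') : vol G pi x r ≤ vol G pi y r' := by
  unfold vol
  apply Finset.sum_le_sum_of_subset_of_nonneg
  · intro z hz
    rw [mem_gball'] at *
    have := h.tri y x z
    linarith
  · intro z _ _
    exact (h.pos z).le

theorem vol_pos {G : SimpleGraph V} {K : V → V → ℝ} {pi : V → ℝ} (h : MK G K pi) {x : V}
    {r : ℝ} (hr : 0 ≤ r) : 0 < vol G pi x r := by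
  unfold vol
  apply Finset.sum_pos
  · intro z _; exact h.pos z
  · exact ⟨x, by rw [mem_gball']; simpa using hr⟩

theorem vd_iter {G : SimpleGraph V} {pi : V → ℝ} {CD : ℝ} (hCD : 0 < CD)
    (hVD : CondVD G pi CD) (x : V) {r : ℝ} (hr : 0 < r) (k : ℕ) :
    vol G pi x (2 ^ k * r) ≤ CD ^ k * vol G pi x r := by
  induction k with
  | zero => simp
  | succ k ih =>
    have h1 := hVD x (2 ^ k * r) (by positivity)
    have e : (2:ℝ) ^ (k+1) * r = 2 * (2 ^ k * r) := by ring
    rw [e]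
    calc _ ≤ _ := h1
      _ ≤ CD * (CD ^ k * vol G pi x r) := by gcongr
      _ = _ := by ring

/-- weights: upper bound -/
theorem wt_upper {G : SimpleGraph V} {K : V → V → ℝ} {pi : V → ℝ} (h : MK G K pi) {CD : ℝ}
    (hCD : 0 < CD) (hVD : CondVD G pi CD) (z : V) {r : ℝ} (hr : 0 < r) (S : Finset V)
    (hS : ∀ y ∈ S, (G.dist z y : ℝ) ≤ 2 * r) :
    ∑ y ∈ S, pi y / vol G pi y r ≤ CD ^ 2 := by
  have hv : 0 < vol G pi z (2 * r) := vol_pos h (by linarith)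
  calc ∑ y ∈ S, pi y / vol G pi y r
      ≤ ∑ y ∈ S, pi y * (CD ^ 2 / vol G pi z (2 * r)) := by
        apply Finset.sum_le_sum
        intro y hy
        rw [div_eq_mul_inv]
        apply mul_le_mul_of_nonneg_left _ (h.pos y).le
        have h1 : vol G pi z (2 * r) ≤ vol G pi y (2 ^ 2 * r) := by
          apply vol_mono h
          rw [MK.sdist]
          linarith [hS y hy]
        have h2 := vd_iter hCD hVD y hr 2
        have h3 : 0 < vol G pi y r := vol_pos h hr.le
        rw [inv_eq_one_div, div_le_div_iff₀ h3 hv]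
        linarith
    _ ≤ vol G pi z (2 * r) * (CD ^ 2 / vol G pi z (2 * r)) := by
        rw [← Finset.sum_mul]
        apply mul_le_mul_of_nonneg_right _ (by positivity)
        unfold vol
        apply Finset.sum_le_sum_of_subset_of_nonneg
        · intro y hy; rw [mem_gball']; exact hS y hy
        · intro y _ _; exact (h.pos y).le
    _ = CD ^ 2 := by field_simp

/-- weights: lower bound -/
theorem wt_lower {G : SimpleGraph V} {K : V → V → ℝ} {pi : V → ℝ} (h : MK G K pi) {CD : ℝ}
    (hCD : 0 < CD) (hVD : CondVD G pi CD) (z : V) {r t : ℝ} (ht : 0 < t)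
    (hr0 : 0 ≤ r) (hr : r + t ≤ 4 * t) :
    1 / CD ^ 2 ≤ ∑ y ∈ gball G z t, pi y / vol G pi y r := by
  have hv : 0 < vol G pi z t := vol_pos h ht.le
  calc 1 / CD ^ 2 = ∑ y ∈ gball G z t, pi y * (1 / (CD ^ 2 * vol G pi z t)) := by
        rw [← Finset.sum_mul]
        change _ = vol G pi z t * _
        field_simp
    _ ≤ _ := by
        apply Finset.sum_le_sum
        intro y hy
        rw [mem_gball'] at hy
        rw [div_eq_mul_inv (pi y)]
        apply mul_le_mul_of_nonneg_left _ (h.pos y).le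
        have h3 : 0 < vol G pi y r := vol_pos h hr0
        have h1 : vol G pi y r ≤ vol G pi z (2 ^ 2 * t) := by
          apply vol_mono h
          linarith
        have h2 := vd_iter hCD hVD z ht 2
        rw [← one_div]
        apply one_div_le_one_div_of_le h3
        linarith

/-- Local Faber-Krahn inequality on one ball. -/
theorem fk_ball {G : SimpleGraph V} {K : V → V → ℝ} {pi : V → ℝ} (h : MK G K pi) {θ CP : ℝ}
    (hPI : CondPI G K pi θ CP) (U : Finset V) (f : V → ℝ)
    (hf : ∀ z, z ∉ U → f z = 0) (y : V) {s : ℝ} (hs : 0 < s)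
    (hU : 2 * ∑ z ∈ U, pi z ≤ vol G pi y s) :
    ∑ z ∈ gball G y s, f z ^ 2 * pi z ≤ 2 * (CP * s ^ θ * en K pi (gball G y s) f) := by
  have h0 := hPI y s hs f
  have hv : 0 < vol G pi y s := vol_pos h hs.le
  have e1 : (∑ ξ ∈ gball G y s, ∑ ζ ∈ gball G y s,
        if G.Adj ξ ζ then |f ξ - f ζ| ^ 2 * K ξ ζ * pi ξ else 0) = en K pi (gball G y s) f := by
    unfold en
    refine Finset.sum_congr rfl fun z _ => Finset.sum_congr rfl fun y _ => h.ite f z y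
  rw [e1] at h0
  set B := gball G y s with hB
  set S := ∑ z ∈ B, f z * pi z with hS
  set Q := ∑ z ∈ B, f z ^ 2 * pi z with hQ
  have hbv : ballAvg G pi y s f = S / vol G pi y s := by
    unfold ballAvg; rw [div_eq_inv_mul]
  have e2 : ∑ z ∈ B, |f z - ballAvg G pi y s f| ^ 2 * pi z = Q - S ^ 2 / vol G pi y s := by
    rw [hbv]
    have : ∀ z ∈ B, |f z - S / vol G pi y s| ^ 2 * pi z
        = f z ^ 2 * pi z - 2 * (S / vol G pi y s) * (f z * pi z)
          + (S / vol G pi y s) ^ 2 * pi z := by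
      intro z _; rw [sq_abs]; ring
    rw [Finset.sum_congr rfl this, Finset.sum_add_distrib, Finset.sum_sub_distrib,
      ← Finset.mul_sum, ← Finset.mul_sum]
    change Q - 2 * (S / vol G pi y s) * S + (S / vol G pi y s) ^ 2 * vol G pi y s = _
    field_simp
    ring
  rw [e2] at h0
  have e3 : S ^ 2 ≤ (∑ z ∈ U, pi z) * Q := by
    have hS' : S = ∑ z ∈ B ∩ U, f z * pi z := by
      rw [hS]; symm
      apply Finset.sum_subset Finset.inter_subset_left
      intro z hz hz'
      rw [hf z (fun hzU => hz' (Finset.mem_inter.mpr ⟨hz, hzU⟩))]; simp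
    have cs := Finset.sum_mul_sq_le_sq_mul_sq (B ∩ U) (fun z => Real.sqrt (pi z))
      (fun z => f z * Real.sqrt (pi z))
    have a1 : ∑ z ∈ B ∩ U, Real.sqrt (pi z) * (f z * Real.sqrt (pi z)) = S := by
      rw [hS']; refine Finset.sum_congr rfl fun z _ => ?_
      have := Real.mul_self_sqrt (h.pos z).le
      calc _ = f z * (Real.sqrt (pi z) * Real.sqrt (pi z)) := by ring
        _ = _ := by rw [this]
    have a2 : ∑ z ∈ B ∩ U, Real.sqrt (pi z) ^ 2 ≤ ∑ z ∈ U, pi z := by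
      calc _ = ∑ z ∈ B ∩ U, pi z :=
            Finset.sum_congr rfl fun z _ => Real.sq_sqrt (h.pos z).le
        _ ≤ _ := Finset.sum_le_sum_of_subset_of_nonneg Finset.inter_subset_right
            fun z _ _ => (h.pos z).le
    have a3 : ∑ z ∈ B ∩ U, (f z * Real.sqrt (pi z)) ^ 2 ≤ Q := by
      calc _ = ∑ z ∈ B ∩ U, f z ^ 2 * pi z :=
            Finset.sum_congr rfl fun z _ => by rw [mul_pow, Real.sq_sqrt (h.pos z).le]
        _ ≤ _ := Finset.sum_le_sum_of_subset_of_nonneg Finset.inter_subset_left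
            fun z _ _ => mul_nonneg (sq_nonneg _) (h.pos z).le
    rw [a1] at cs
    refine cs.trans (mul_le_mul a2 a3 ?_ ?_)
    · exact Finset.sum_nonneg fun z _ => sq_nonneg _
    · exact Finset.sum_nonneg fun z _ => (h.pos z).le
  have hQ0 : 0 ≤ Q := Finset.sum_nonneg fun z _ => mul_nonneg (sq_nonneg _) (h.pos z).le
  have e4 : S ^ 2 / vol G pi y s ≤ Q / 2 := by
    rw [div_le_iff₀ hv]
    nlinarith
  linarith

theorem en_nonneg {G : SimpleGraph V} {K : V → V → ℝ} {pi : V → ℝ} (h : MK G K pi)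
    (S : Finset V) (f : V → ℝ) : 0 ≤ en K pi S f :=
  Finset.sum_nonneg fun z _ => Finset.sum_nonneg fun y _ =>
    mul_nonneg (mul_nonneg (sq_nonneg _) (h.nn z y)) (h.pos z).le

/-- Averaging energies (and masses) over balls with weights. -/
theorem wt_avg {G : SimpleGraph V} {K : V → V → ℝ} {pi : V → ℝ} (h : MK G K pi) {CD : ℝ}
    (hCD : 0 < CD) (hVD : CondVD G pi CD) {s t : ℝ} (hs : 0 < s) (ht : t ≤ 2 * s)
    (T A : Finset V) (hTA : ∀ y ∈ T, gball G y t ⊆ A) (c : V → V → ℝ)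
    (hc : ∀ z y, 0 ≤ c z y) :
    ∑ y ∈ T, pi y / vol G pi y s * ∑ a ∈ gball G y t, ∑ b ∈ gball G y t, c a b
      ≤ CD ^ 2 * ∑ a ∈ A, ∑ b ∈ A, c a b := by
  have hw : ∀ y, 0 ≤ pi y / vol G pi y s := fun y =>
    div_nonneg (h.pos y).le (vol_pos h hs.le).le
  calc _ ≤ ∑ y ∈ T, pi y / vol G pi y s *
          ∑ a ∈ A, if (G.dist a y : ℝ) ≤ t then ∑ b ∈ A, c a b else 0 := by
        apply Finset.sum_le_sum
        intro y hy
        apply mul_le_mul_of_nonneg_left _ (hw y)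
        rw [← Finset.sum_filter]
        apply Finset.sum_le_sum_of_subset_of_nonneg _ _ |>.trans' 
        · apply Finset.sum_le_sum
          intro a ha
          exact Finset.sum_le_sum_of_subset_of_nonneg (hTA y hy) fun b _ _ => hc a b
        · intro a ha
          rw [Finset.mem_filter]
          refine ⟨hTA y hy ha, ?_⟩
          rw [mem_gball'] at ha
          rw [MK.sdist]; exact ha
        · intro a _ _
          exact Finset.sum_nonneg fun b _ => hc a b
    _ = ∑ a ∈ A, (∑ y ∈ T with (G.dist a y : ℝ) ≤ t, pi y / vol G pi y s) * ∑ b ∈ A, c a b := by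
        simp_rw [Finset.mul_sum (s := A) (f := fun a => if _ then _ else _)]
        rw [Finset.sum_comm]
        refine Finset.sum_congr rfl fun a _ => ?_
        rw [Finset.sum_filter, ← Finset.mul_sum, Finset.sum_mul]
        refine Finset.sum_congr rfl fun y _ => ?_
        split_ifs <;> simp
    _ ≤ ∑ a ∈ A, CD ^ 2 * ∑ b ∈ A, c a b := by
        apply Finset.sum_le_sum
        intro a _
        apply mul_le_mul_of_nonneg_right _ (Finset.sum_nonneg fun b _ => hc a b)
        apply wt_upper h hCD hVD a hs
        intro y hy
        exact (Finset.mem_filter.mp hy).2.trans ht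
    _ = _ := by rw [Finset.mul_sum]

theorem wt_avg1 {G : SimpleGraph V} {K : V → V → ℝ} {pi : V → ℝ} (h : MK G K pi) {CD : ℝ}
    (hCD : 0 < CD) (hVD : CondVD G pi CD) {s t : ℝ} (hs : 0 < s) (ht : t ≤ 2 * s) 
    (T A : Finset V) (hTA : ∀ y ∈ T, gball G y t ⊆ A) (c : V → ℝ)
    (hc : ∀ z, 0 ≤ c z) :
    ∑ y ∈ T, pi y / vol G pi y s * ∑ a ∈ gball G y t, c a
      ≤ CD ^ 2 * ∑ a ∈ A, c a := by
  have := wt_avg h hCD hVD hs ht T A hTA (fun a b => if a = b then c a else 0)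
    (fun z y => by split_ifs; exacts [hc z, le_rfl])
  simp only [Finset.sum_ite_eq] at this
  have e : ∀ S : Finset V, (∑ a ∈ S, if a ∈ S then c a else 0) = ∑ a ∈ S, c a := fun S =>
    Finset.sum_congr rfl fun a ha => by simp [ha]
  simp_rw [e] at this
  exact this

/-- Faber-Krahn inequality. -/
theorem fk {G : SimpleGraph V} {K : V → V → ℝ} {pi : V → ℝ} (h : MK G K pi) {θ CP CD : ℝ}
    (hCD : 0 < CD) (hVD : CondVD G pi CD) (hCP : 0 < CP)
    (hPI : CondPI G K pi θ CP) (U : Finset V) (f : V → ℝ)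
    (hf : ∀ z, z ∉ U → f z = 0) {s : ℝ} (hs : 0 < s)
    (hU : ∀ y, (∃ z ∈ U, (G.dist y z : ℝ) ≤ s) → 2 * ∑ z ∈ U, pi z ≤ vol G pi y s) :
    ∑ z, f z ^ 2 * pi z ≤ 2 * CD ^ 4 * CP * s ^ θ * en K pi univ f := by
  have hw : ∀ y, 0 ≤ pi y / vol G pi y s := fun y =>
    div_nonneg (h.pos y).le (vol_pos h hs.le).le
  have hst : 0 ≤ s ^ θ := Real.rpow_nonneg hs.le _
  have h1 : ∀ y, ∑ z ∈ gball G y s, f z ^ 2 * pi z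
      ≤ 2 * (CP * s ^ θ * en K pi (gball G y s) f) := by
    intro y
    by_cases hy : ∃ z ∈ U, (G.dist y z : ℝ) ≤ s
    · exact fk_ball h hPI U f hf y hs (hU y hy)
    · have : ∑ z ∈ gball G y s, f z ^ 2 * pi z = 0 := by
        apply Finset.sum_eq_zero
        intro z hz
        rw [mem_gball'] at hz
        rw [hf z (fun hzU => hy ⟨z, hzU, hz⟩)]; simp
      rw [this]
      have := en_nonneg h (gball G y s) f
      positivity
  have h2 : ∑ y, pi y / vol G pi y s * ∑ z ∈ gball G y s, f z ^ 2 * pi z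
      ≤ ∑ y, 2 * CP * s ^ θ * (pi y / vol G pi y s * en K pi (gball G y s) f) := by
    apply Finset.sum_le_sum
    intro y _
    calc _ ≤ _ := mul_le_mul_of_nonneg_left (h1 y) (hw y)
      _ = _ := by ring
  have h3 := wt_avg h hCD hVD hs (t := s) (by linarith) univ univ (fun _ _ => subset_univ _)
    (fun z y => (f z - f y) ^ 2 * K z y * pi z)
    (fun z y => mul_nonneg (mul_nonneg (sq_nonneg _) (h.nn z y)) (h.pos z).le)
  rw [← Finset.mul_sum] at h2
  have h4 : ∑ z, (1 / CD ^ 2) * (f z ^ 2 * pi z)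
      ≤ ∑ y, pi y / vol G pi y s * ∑ z ∈ gball G y s, f z ^ 2 * pi z := by
    calc _ ≤ ∑ z, (∑ y ∈ gball G z s, pi y / vol G pi y s) * (f z ^ 2 * pi z) := by
          apply Finset.sum_le_sum
          intro z _
          apply mul_le_mul_of_nonneg_right _ (mul_nonneg (sq_nonneg _) (h.pos z).le)
          exact wt_lower h hCD hVD z hs hs.le (by linarith)
      _ = _ := by
          unfold gball
          simp_rw [Finset.sum_filter, Finset.sum_mul, Finset.mul_sum]
          rw [Finset.sum_comm]
          refine Finset.sum_congr rfl fun y _ => Finset.sum_congr rfl fun z _ => ?_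
          rw [MK.sdist z y]
          split_ifs <;> simp
  rw [← Finset.mul_sum] at h4
  have h5 : 1 / CD ^ 2 * ∑ z, f z ^ 2 * pi z ≤ 2 * CP * s ^ θ * (CD ^ 2 * en K pi univ f) := by
    refine h4.trans (h2.trans ?_)
    apply mul_le_mul_of_nonneg_left h3 (by positivity)
  rw [div_mul_eq_mul_div, one_mul, div_le_iff₀ (by positivity)] at h5
  linarith

/-- Green formula. -/
theorem green_id {G : SimpleGraph V} {K : V → V → ℝ} {pi : V → ℝ} (h : MK G K pi)
    (w g : V → ℝ) :
    ∑ z, ∑ y, (w z - w y) * (g z - g y) * K z y * pi z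
      = 2 * ∑ z, g z * (w z - ∑ y, K z y * w y) * pi z := by
  have e1 : ∑ z, ∑ y, (w z - w y) * g y * K z y * pi z
      = - ∑ z, ∑ y, (w z - w y) * g z * K z y * pi z := by
    rw [Finset.sum_comm, ← Finset.sum_neg_distrib]
    refine Finset.sum_congr rfl fun z _ => ?_
    rw [← Finset.sum_neg_distrib]
    refine Finset.sum_congr rfl fun y _ => ?_
    have := h.rev y z
    linear_combination ((w y - w z) * g z) * this
  have e2 : ∑ z, ∑ y, (w z - w y) * g z * K z y * pi z
      = ∑ z, g z * (w z - ∑ y, K z y * w y) * pi z := by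
    refine Finset.sum_congr rfl fun z _ => ?_
    have : w z = ∑ y, K z y * w z := by rw [← Finset.sum_mul, h.sum1, one_mul]
    calc _ = ∑ y, g z * pi z * (K z y * w z - K z y * w y) :=
          Finset.sum_congr rfl fun y _ => by ring
      _ = g z * pi z * (∑ y, K z y * w z - ∑ y, K z y * w y) := by
          rw [← Finset.mul_sum, Finset.sum_sub_distrib]
      _ = _ := by rw [← this]; ring
  have e3 : ∑ z, ∑ y, (w z - w y) * (g z - g y) * K z y * pi z
      = ∑ z, ∑ y, (w z - w y) * g z * K z y * pi z
        - ∑ z, ∑ y, (w z - w y) * g y * K z y * pi z := by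
    rw [← Finset.sum_sub_distrib]
    refine Finset.sum_congr rfl fun z _ => ?_
    rw [← Finset.sum_sub_distrib]
    refine Finset.sum_congr rfl fun y _ => by ring
  rw [e3, e1, e2]; ring

/-- One De Giorgi step for the (discounted) exit time function. -/
theorem dg_step {G : SimpleGraph V} {K : V → V → ℝ} {pi : V → ℝ} (h : MK G K pi) {θ CP CD : ℝ}
    (hCD : 0 < CD) (hVD : CondVD G pi CD) (hCP : 0 < CP)
    (hPI : CondPI G K pi θ CP) {l : ℝ} (hl : 0 < l) (U : Finset V) (w : V → ℝ)
    (hw0 : ∀ z, 0 ≤ w z) (hwU : ∀ z ∈ U, (1 + l) * w z = ∑ y, K z y * w y + 1)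
    (hwo : ∀ z, z ∉ U → w z = 0) {a b : ℝ} (ha : 0 ≤ a) {s : ℝ} (hs : 0 < s)
    (hU : ∀ y, (∃ z ∈ U, (G.dist y z : ℝ) ≤ s) →
      2 * ∑ z with a < w z, pi z ≤ vol G pi y s) :
    (b - a) * ∑ z with b < w z, pi z
      ≤ 4 * CD ^ 4 * CP * s ^ θ * ∑ z with a < w z, pi z := by
  set Ua : Finset V := univ.filter (fun z => a < w z) with hUa
  set g : V → ℝ := fun z => max (w z - a) 0 with hg
  have hg0 : ∀ z, 0 ≤ g z := fun z => le_max_right _ _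
  have hUaU : Ua ⊆ U := by
    intro z hz
    by_contra hzU
    rw [hUa, Finset.mem_filter, hwo z hzU] at hz
    linarith [hz.2]
  have hgo : ∀ z, z ∉ Ua → g z = 0 := by
    intro z hz
    rw [hUa, Finset.mem_filter] at hz
    simp only [mem_univ, true_and, not_lt] at hz
    exact max_eq_right (by linarith)
  have hfk := fk h hCD hVD hCP hPI Ua g hgo hs (by
    rintro y ⟨z, hz, hd⟩
    exact hU y ⟨z, hUaU hz, hd⟩)
  -- energy
  have hen : en K pi univ g ≤ 2 * ∑ z, g z * pi z := by
    calc en K pi univ g ≤ ∑ z, ∑ y, (w z - w y) * (g z - g y) * K z y * pi z := by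
          unfold en
          refine Finset.sum_le_sum fun z _ => Finset.sum_le_sum fun y _ => ?_
          apply mul_le_mul_of_nonneg_right _ (h.pos z).le
          apply mul_le_mul_of_nonneg_right _ (h.nn z y)
          simp only [hg]
          rcases le_total (w z - a) 0 with h1 | h1 <;> rcases le_total (w y - a) 0 with h2 | h2 <;>
            simp only [max_eq_left, max_eq_right, h1, h2] <;> nlinarith
      _ = 2 * ∑ z, g z * (w z - ∑ y, K z y * w y) * pi z := green_id h w g
      _ ≤ 2 * ∑ z, g z * pi z := by
          apply mul_le_mul_of_nonneg_left _ (by norm_num)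
          refine Finset.sum_le_sum fun z _ => ?_
          apply mul_le_mul_of_nonneg_right _ (h.pos z).le
          by_cases hz : z ∈ U
          · have := hwU z hz
            have h1 : w z - ∑ y, K z y * w y ≤ 1 := by nlinarith [hw0 z]
            nlinarith [hg0 z]
          · rw [hgo z (fun hh => hz (hUaU hh))]; simp
  set I := ∑ z, g z * pi z with hI
  set m := ∑ z ∈ Ua, pi z with hm
  have hI0 : 0 ≤ I := Finset.sum_nonneg fun z _ => mul_nonneg (hg0 z) (h.pos z).le
  have hm0 : 0 ≤ m := Finset.sum_nonneg fun z _ => (h.pos z).le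
  have hcs : I ^ 2 ≤ m * ∑ z, g z ^ 2 * pi z := by
    have hS' : I = ∑ z ∈ Ua, g z * pi z := by
      rw [hI]; symm
      apply Finset.sum_subset (subset_univ _)
      intro z _ hz
      rw [hgo z hz]; simp
    have cs := Finset.sum_mul_sq_le_sq_mul_sq Ua (fun z => Real.sqrt (pi z))
      (fun z => g z * Real.sqrt (pi z))
    have a1 : ∑ z ∈ Ua, Real.sqrt (pi z) * (g z * Real.sqrt (pi z)) = I := by
      rw [hS']; refine Finset.sum_congr rfl fun z _ => ?_
      have := Real.mul_self_sqrt (h.pos z).le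
      calc _ = g z * (Real.sqrt (pi z) * Real.sqrt (pi z)) := by ring
        _ = _ := by rw [this]
    have a2 : ∑ z ∈ Ua, Real.sqrt (pi z) ^ 2 = m :=
      Finset.sum_congr rfl fun z _ => Real.sq_sqrt (h.pos z).le
    have a3 : ∑ z ∈ Ua, (g z * Real.sqrt (pi z)) ^ 2 ≤ ∑ z, g z ^ 2 * pi z := by
      calc _ = ∑ z ∈ Ua, g z ^ 2 * pi z :=
            Finset.sum_congr rfl fun z _ => by rw [mul_pow, Real.sq_sqrt (h.pos z).le]
        _ ≤ _ := Finset.sum_le_sum_of_subset_of_nonneg (subset_univ _)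
            fun z _ _ => mul_nonneg (sq_nonneg _) (h.pos z).le
    rw [a1, a2] at cs
    exact cs.trans (mul_le_mul_of_nonneg_left a3 hm0)
  have hst : 0 ≤ s ^ θ := Real.rpow_nonneg hs.le _
  set c := 2 * CD ^ 4 * CP * s ^ θ with hc
  have hc0 : 0 ≤ c := by positivity
  have h1 : I ^ 2 ≤ m * (c * (2 * I)) := by
    refine hcs.trans (mul_le_mul_of_nonneg_left ?_ hm0)
    exact hfk.trans (mul_le_mul_of_nonneg_left hen hc0)
  have h2 : I ≤ 2 * c * m := by
    rcases hI0.eq_or_lt with h0 | h0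
    · rw [← h0]; positivity
    · have : I * I ≤ (2 * c * m) * I := by nlinarith
      exact le_of_mul_le_mul_right this h0
  have h3 : (b - a) * ∑ z with b < w z, pi z ≤ I := by
    rw [Finset.mul_sum, hI]
    calc _ ≤ ∑ z with b < w z, g z * pi z := by
          refine Finset.sum_le_sum fun z hz => ?_
          apply mul_le_mul_of_nonneg_right _ (h.pos z).le
          have := (Finset.mem_filter.mp hz).2
          exact le_trans (by linarith) (le_max_left _ _)
      _ ≤ _ := Finset.sum_le_sum_of_subset_of_nonneg (subset_univ _)
            fun z _ _ => mul_nonneg (hg0 z) (h.pos z).le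
  refine h3.trans (h2.trans (le_of_eq ?_))
  rw [hc]; ring

/-- Sup bound for the (discounted) exit time from a small set. -/
theorem supw {G : SimpleGraph V} {K : V → V → ℝ} {pi : V → ℝ} (h : MK G K pi) {θ CP CD : ℝ}
    (hθ : 2 ≤ θ) (hCD : 2 ≤ CD) (hVD : CondVD G pi CD) (hCP : 0 < CP)
    (hPI : CondPI G K pi θ CP) {l : ℝ} (hl : 0 < l) (U : Finset V) (w : V → ℝ)
    (hw0 : ∀ z, 0 ≤ w z) (hwU : ∀ z ∈ U, (1 + l) * w z = ∑ y, K z y * w y + 1)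
    (hwo : ∀ z, z ∉ U → w z = 0) (x : V) {r : ℝ} (hr : 0 < r) (hUr : U ⊆ gball G x r) (k : ℕ)
    (hUv : (2 * CD ^ (k + 2)) * ∑ z ∈ U, pi z ≤ vol G pi x r) (z : V) :
    w z ≤ 2 * (4 * CD ^ 5 * CP * (r / 2 ^ k) ^ θ) := by
  have hCD0 : 0 < CD := by linarith
  set D0 := 4 * CD ^ 5 * CP * (r / 2 ^ k) ^ θ with hD0
  have hD0p : 0 < D0 := by positivity
  set t : ℕ → ℝ := fun j => 2 * D0 * (1 - 1 / 2 ^ j) with ht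
  have ht0 : ∀ j, 0 ≤ t j := by
    intro j
    have : (1:ℝ) / 2 ^ j ≤ 1 := by
      rw [div_le_one (by positivity)]; exact one_le_pow₀ (by norm_num)
    simp only [ht]
    apply mul_nonneg (by positivity); linarith
  have key : ∀ j : ℕ, (2 * CD ^ (k + j + 2)) * ∑ z with t j < w z, pi z ≤ vol G pi x r := by
    intro j
    induction j with
    | zero =>
      refine le_trans ?_ hUv
      apply mul_le_mul_of_nonneg_left _ (by positivity)
      apply Finset.sum_le_sum_of_subset_of_nonneg
      · intro z hz
        by_contra hzU
        have := (Finset.mem_filter.mp hz).2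
        rw [hwo z hzU] at this
        linarith [ht0 0]
      · intro z _ _; exact (h.pos z).le
    | succ j ih =>
      have hs : 0 < r / 2 ^ (k + j) := by positivity
      have hstep := dg_step h hCD0 hVD hCP hPI hl U w hw0 hwU hwo (ht0 j) (b := t (j+1)) hs (by
        rintro y ⟨z, hzU, hd⟩
        have hzx := hUr hzU
        rw [mem_gball'] at hzx
        have h1 : vol G pi x r ≤ vol G pi y (2 ^ (k + j + 2) * (r / 2 ^ (k + j))) := by
          apply vol_mono h
          have e : (2:ℝ) ^ (k + j + 2) * (r / 2 ^ (k + j)) = 4 * r := by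
            rw [pow_add (2:ℝ) (k+j) 2]; field_simp; norm_num
          rw [e]
          have h2 := h.tri y z x
          rw [MK.sdist z x] at h2
          have h3 : r / 2 ^ (k + j) ≤ r := by
            apply div_le_self hr.le; exact one_le_pow₀ (by norm_num)
          linarith
        have h2 := vd_iter hCD0 hVD y hs (k + j + 2)
        have h3 : CD ^ (k + j + 2) * (2 * ∑ z with t j < w z, pi z)
            ≤ CD ^ (k + j + 2) * vol G pi y (r / 2 ^ (k + j)) := by linarith
        exact le_of_mul_le_mul_left h3 (by positivity))
      set m' := ∑ z with t (j+1) < w z, pi z with hm'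
      set m := ∑ z with t j < w z, pi z with hm
      have hm0 : 0 ≤ m := Finset.sum_nonneg fun z _ => (h.pos z).le
      have e1 : t (j+1) - t j = D0 / 2 ^ j := by
        simp only [ht, pow_succ]; field_simp; ring
      have e2 : (r / 2 ^ (k + j)) ^ θ ≤ (r / 2 ^ k) ^ θ / 2 ^ j := by
        rw [pow_add, ← div_div, Real.div_rpow (by positivity) (by positivity)]
        apply div_le_div_of_nonneg_left (by positivity) (by positivity)
        calc (2:ℝ) ^ j = ((2:ℝ) ^ j) ^ (1:ℝ) := by rw [Real.rpow_one]
          _ ≤ _ := Real.rpow_le_rpow_of_exponent_le (one_le_pow₀ (by norm_num)) (by linarith)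
      rw [e1] at hstep
      have h5 : D0 / 2 ^ j * m' ≤ 4 * CD ^ 4 * CP * ((r / 2 ^ k) ^ θ / 2 ^ j) * m := by
        refine hstep.trans ?_
        apply mul_le_mul_of_nonneg_right _ hm0
        apply mul_le_mul_of_nonneg_left e2 (by positivity)
      have h6 : CD * m' ≤ m := by
        have h7 : (4 * CD ^ 4 * CP * (r / 2 ^ k) ^ θ / 2 ^ j) * (CD * m')
            ≤ (4 * CD ^ 4 * CP * (r / 2 ^ k) ^ θ / 2 ^ j) * m := by
          calc _ = D0 / 2 ^ j * m' := by rw [hD0]; ring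
            _ ≤ _ := h5
            _ = _ := by ring
        exact le_of_mul_le_mul_left h7 (by positivity)
      calc 2 * CD ^ (k + (j + 1) + 2) * m' = 2 * CD ^ (k + j + 2) * (CD * m') := by ring
        _ ≤ 2 * CD ^ (k + j + 2) * m := by gcongr
        _ ≤ _ := ih
  by_contra hz
  push Not at hz
  have hlow : ∀ j : ℕ, (2:ℝ) ^ j * pi z ≤ vol G pi x r := by
    intro j
    have hp : pi z ≤ ∑ z with t j < w z, pi z := by
      apply Finset.single_le_sum (f := pi) (fun i _ => (h.pos i).le)
      rw [Finset.mem_filter]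
      refine ⟨mem_univ _, lt_of_le_of_lt ?_ hz⟩
      simp only [ht]
      have : (0:ℝ) ≤ 1 / 2 ^ j := by positivity
      nlinarith
    refine le_trans ?_ (key j)
    apply mul_le_mul _ hp (h.pos z).le (by positivity)
    calc (2:ℝ) ^ j ≤ CD ^ j := pow_le_pow_left₀ (by norm_num) hCD j
      _ ≤ CD ^ (k + j + 2) := pow_le_pow_right₀ (by linarith) (by omega)
      _ ≤ 2 * CD ^ (k + j + 2) := by linarith [pow_pos hCD0 (k + j + 2)]
  obtain ⟨j, hj⟩ := pow_unbounded_of_one_lt (vol G pi x r / pi z) (one_lt_two)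
  rw [div_lt_iff₀ (h.pos z)] at hj
  exact absurd (hlow j) (not_le.mpr hj)

/-- Cut-off for one ball. -/
theorem cut1 {G : SimpleGraph V} {K : V → V → ℝ} {pi : V → ℝ} (h : MK G K pi)
    {θ C1 C2 ε : ℝ} (hCS : CondCS G K pi θ C1 C2 ε) (y : V) {ρ : ℝ} (hρ : 1 ≤ ρ) :
    ∃ σ : V → ℝ, (∀ z, 0 ≤ σ z) ∧ (∀ z, (G.dist y z : ℝ) ≤ ρ / 2 → σ z = 1) ∧
      (∀ z, ρ < G.dist y z → σ z = 0) ∧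
      ∀ f : V → ℝ, ∑ z, f z ^ 2 * ∑ u, (σ z - σ u) ^ 2 * K z u * pi z ≤
        (3 * C2 + 2) * (en K pi (gball G y (2 * ρ)) f
          + ρ ^ (-θ) * ∑ z ∈ gball G y (2 * ρ), f z ^ 2 * pi z) := by
  have hρ0 : 0 < ρ := by linarith
  obtain ⟨τ, h1, h2, -, h4⟩ := hCS y ρ hρ0
  refine ⟨fun z => min 1 (max 0 (τ z)), ?_, ?_, ?_, ?_⟩
  · intro z; exact le_min zero_le_one (le_max_left _ _)
  · intro z hz
    have := h1 z (mem_gball'.mpr hz)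
    exact min_eq_left (this.trans (le_max_right _ _))
  · intro z hz
    have := h2 z (by rw [mem_gball']; linarith)
    simp [this]
  intro f
  set σ : V → ℝ := fun z => min 1 (max 0 (τ z)) with hσ
  have hσ1 : ∀ z u, (σ z - σ u) ^ 2 ≤ (τ z - τ u) ^ 2 := by
    intro z u
    rw [sq_le_sq]
    simp only [hσ]
    exact (abs_min_sub_min_le_max 1 _ 1 _).trans (by
      simp only [sub_self, abs_zero]
      rw [max_eq_right (abs_nonneg _)]
      refine (abs_max_sub_max_le_max 0 _ 0 _).trans ?_
      simp)
  have hσ2 : ∀ z u, (σ z - σ u) ^ 2 ≤ 1 := by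
    intro z u
    have a1 : 0 ≤ σ z := le_min zero_le_one (le_max_left _ _)
    have a2 : 0 ≤ σ u := le_min zero_le_one (le_max_left _ _)
    have a3 : σ z ≤ 1 := min_le_left _ _
    have a4 : σ u ≤ 1 := min_le_left _ _
    nlinarith
  have hσ0 : ∀ z, z ∉ gball G y ρ → σ z = 0 := by
    intro z hz
    simp [hσ, h2 z hz]
  set B := gball G y ρ with hB
  set R := en K pi (gball G y (2 * ρ)) f
          + ρ ^ (-θ) * ∑ z ∈ gball G y (2 * ρ), f z ^ 2 * pi z with hR
  have hin : ∑ z ∈ B, f z ^ 2 * ∑ u, (σ z - σ u) ^ 2 * K z u * pi z ≤ C2 * R := by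
    have h5 := h4 ρ hρ0 le_rfl f
    simp only [h.ite] at h5
    rw [div_self hρ0.ne', Real.one_rpow, mul_one] at h5
    simp only [sq_abs] at h5
    refine le_trans ?_ h5
    refine Finset.sum_le_sum fun z _ => mul_le_mul_of_nonneg_left ?_ (sq_nonneg _)
    refine Finset.sum_le_sum fun u _ => ?_
    exact mul_le_mul_of_nonneg_right (mul_le_mul_of_nonneg_right (hσ1 z u) (h.nn z u)) (h.pos z).le
  have hsum0 : 0 ≤ ρ ^ (-θ) * ∑ z ∈ gball G y (2 * ρ), f z ^ 2 * pi z :=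
    mul_nonneg (Real.rpow_nonneg hρ0.le _)
      (Finset.sum_nonneg fun z _ => mul_nonneg (sq_nonneg _) (h.pos z).le)
  have hout : ∑ z ∈ Bᶜ, f z ^ 2 * ∑ u, (σ z - σ u) ^ 2 * K z u * pi z ≤ 2 * (C2 * R) + 2 * R := by
    calc _ ≤ ∑ z ∈ Bᶜ, ∑ u ∈ B, (2 * (f u ^ 2 * ((σ u - σ z) ^ 2 * K u z * pi u))
              + if z ∈ gball G y (2 * ρ) then
                  2 * ((f z - f u) ^ 2 * K z u * pi z) else 0) := by
          refine Finset.sum_le_sum fun z hz => ?_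
          rw [Finset.mem_compl] at hz
          rw [Finset.mul_sum]
          rw [← Finset.sum_subset (subset_univ B) (by
            intro u _ hu
            rw [hσ0 z hz, hσ0 u hu]; simp)]
          refine Finset.sum_le_sum fun u hu => ?_
          by_cases hk : K z u = 0
          · have hk' : K u z = 0 := by
              have := h.rev z u
              rw [hk, mul_zero] at this
              rcases mul_eq_zero.mp this.symm with h0 | h0
              · exact absurd h0 (h.pos u).ne'
              · exact h0
            rw [hk, hk']; simp
          · have hz2 : z ∈ gball G y (2 * ρ) := by
              rw [mem_gball'] at *
              have := h.step hk
              have t := h.tri y u z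
              rw [MK.sdist u z] at t
              linarith
            rw [if_pos hz2]
            have hrev := h.rev z u
            have hkp : 0 ≤ K z u * pi z := mul_nonneg (h.nn z u) (h.pos z).le
            have e1 : (σ u - σ z) ^ 2 * K u z * pi u = (σ z - σ u) ^ 2 * (K z u * pi z) := by
              linear_combination (-(σ u - σ z) ^ 2) * hrev
            rw [e1]
            have e2 : f z ^ 2 ≤ 2 * f u ^ 2 + 2 * (f z - f u) ^ 2 := by
              nlinarith [sq_nonneg (f z - 2 * f u)]
            have e3 : f z ^ 2 * (σ z - σ u) ^ 2 ≤
                2 * f u ^ 2 * (σ z - σ u) ^ 2 + 2 * (f z - f u) ^ 2 := by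
              nlinarith [hσ2 z u, sq_nonneg (σ z - σ u), sq_nonneg (f z - f u)]
            nlinarith
      _ = 2 * ∑ u ∈ B, f u ^ 2 * ∑ z ∈ Bᶜ, (σ u - σ z) ^ 2 * K u z * pi u
          + ∑ z ∈ Bᶜ with z ∈ gball G y (2 * ρ), 2 * ∑ u ∈ B, (f z - f u) ^ 2 * K z u * pi z := by
          simp_rw [Finset.sum_add_distrib]
          congr 1
          · rw [Finset.sum_comm, Finset.mul_sum]
            refine Finset.sum_congr rfl fun u _ => ?_
            rw [Finset.mul_sum, Finset.mul_sum]
          · rw [Finset.sum_filter]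
            refine Finset.sum_congr rfl fun z _ => ?_
            split_ifs
            · rw [Finset.mul_sum]
            · simp
      _ ≤ 2 * (C2 * R) + 2 * R := by
          apply add_le_add
          · apply mul_le_mul_of_nonneg_left _ (by norm_num)
            refine le_trans ?_ hin
            refine Finset.sum_le_sum fun z _ => mul_le_mul_of_nonneg_left ?_ (sq_nonneg _)
            exact Finset.sum_le_sum_of_subset_of_nonneg (subset_univ _) fun u _ _ =>
              mul_nonneg (mul_nonneg (sq_nonneg _) (h.nn z u)) (h.pos z).le
          · rw [← Finset.mul_sum]
            apply mul_le_mul_of_nonneg_left _ (by norm_num)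
            refine le_trans ?_ (le_add_of_nonneg_right hsum0)
            unfold en
            have hsub : B ⊆ gball G y (2 * ρ) := by
              intro u hu; rw [mem_gball'] at *; linarith
            refine le_trans (Finset.sum_le_sum fun z _ =>
              Finset.sum_le_sum_of_subset_of_nonneg hsub fun u _ _ =>
              mul_nonneg (mul_nonneg (sq_nonneg _) (h.nn z u)) (h.pos z).le) ?_
            apply Finset.sum_le_sum_of_subset_of_nonneg
            · intro z hz; exact (Finset.mem_filter.mp hz).2
            · intro z _ _
              exact Finset.sum_nonneg fun u _ =>
                mul_nonneg (mul_nonneg (sq_nonneg _) (h.nn z u)) (h.pos z).le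
  rw [← Finset.sum_add_sum_compl B]
  linarith

/-- Cut-off for an annulus. -/
theorem shell {G : SimpleGraph V} {K : V → V → ℝ} {pi : V → ℝ} (h : MK G K pi)
    {θ C1 C2 ε CD : ℝ} (hCD : 0 < CD) (hVD : CondVD G pi CD) (hC2 : 0 < C2)
    (hCS : CondCS G K pi θ C1 C2 ε) (x : V) (a : ℝ) {ρ : ℝ} (hρ : 1 ≤ ρ) :
    ∃ φ : V → ℝ, (∀ z, 0 ≤ φ z) ∧ (∀ z, (G.dist x z : ℝ) ≤ a → φ z = 1) ∧
      (∀ z, a + 2 * ρ < G.dist x z → φ z = 0) ∧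
      ∀ f : V → ℝ, ∑ z, f z ^ 2 * ∑ u, (φ z - φ u) ^ 2 * K z u * pi z ≤
        (CD ^ 8 * (3 * C2 + 2)) *
          (en K pi (gball G x (a + 7 * ρ) \ gball G x (a - 5 * ρ)) f
          + ρ ^ (-θ) * ∑ z ∈ gball G x (a + 7 * ρ) \ gball G x (a - 5 * ρ), f z ^ 2 * pi z) := by
  have hρ0 : 0 < ρ := by linarith
  choose σ s0 s1 s2 s3 using fun y => cut1 h hCS y hρ
  set w : V → ℝ := fun y => pi y / vol G pi y ρ with hw
  have hw0 : ∀ y, 0 ≤ w y := fun y => div_nonneg (h.pos y).le (vol_pos h hρ0.le).le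
  set T := gball G x (a + ρ) with hT
  set φ0 : V → ℝ := fun z => ∑ y ∈ T, w y * σ y z with hφ0
  have hφ00 : ∀ z, 0 ≤ φ0 z := fun z => Finset.sum_nonneg fun y _ => mul_nonneg (hw0 y) (s0 y z)
  have hfar : ∀ y z u, K z u ≠ 0 → 2 * ρ < G.dist z y → σ y z = 0 ∧ σ y u = 0 := by
    intro y z u hk hd
    have h1 := h.step hk
    have h2 := h.tri z u y
    refine ⟨s2 y z ?_, s2 y u ?_⟩
    · rw [MK.sdist]; linarith
    · rw [MK.sdist]; linarith
  have hsup : ∀ z, a + 2 * ρ < G.dist x z → φ0 z = 0 := by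
    intro z hz
    apply Finset.sum_eq_zero
    intro y hy
    rw [hT, mem_gball'] at hy
    have := h.tri x y z
    rw [s2 y z (by linarith), mul_zero]
  set φ : V → ℝ := fun z => min 1 (CD ^ 2 * φ0 z) with hφ
  have hone : ∀ z, (G.dist x z : ℝ) ≤ a → φ z = 1 := by
    intro z hz
    have hl := wt_lower h hCD hVD z (t := ρ / 2) (r := ρ) (by linarith) hρ0.le (by linarith)
    have h1 : 1 / CD ^ 2 ≤ φ0 z := by
      refine hl.trans ?_
      calc _ = ∑ y ∈ gball G z (ρ / 2), w y * σ y z := by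
            refine Finset.sum_congr rfl fun y hy => ?_
            rw [mem_gball'] at hy
            rw [s1 y z (by rw [MK.sdist]; exact hy), mul_one]
        _ ≤ _ := by
            apply Finset.sum_le_sum_of_subset_of_nonneg
            · intro y hy
              rw [hT]
              rw [mem_gball'] at *
              have := h.tri x z y
              linarith
            · intro y _ _; exact mul_nonneg (hw0 y) (s0 y z)
    apply min_eq_left
    rw [div_le_iff₀ (by positivity)] at h1
    linarith
  have hzero : ∀ z, a + 2 * ρ < G.dist x z → φ z = 0 := by
    intro z hz
    simp only [hφ, hsup z hz, mul_zero]
    exact min_eq_right zero_le_one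
  refine ⟨φ, ?_, hone, hzero, ?_⟩
  · intro z; exact le_min zero_le_one (mul_nonneg (by positivity) (hφ00 z))
  intro f
  -- pointwise bound
  have hpt : ∀ z u, (φ z - φ u) ^ 2 * K z u * pi z
      ≤ CD ^ 6 * ∑ y ∈ T, w y * ((σ y z - σ y u) ^ 2 * K z u * pi z) := by
    intro z u
    by_cases hk : K z u = 0
    · rw [hk]; simp
    have hkp : 0 ≤ K z u * pi z := mul_nonneg (h.nn z u) (h.pos z).le
    have h1 : (φ z - φ u) ^ 2 ≤ (CD ^ 2) ^ 2 * (φ0 z - φ0 u) ^ 2 := by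
      rw [← mul_pow, sq_le_sq]
      simp only [hφ]
      refine (abs_min_sub_min_le_max 1 _ 1 _).trans ?_
      simp only [sub_self, abs_zero]
      rw [max_eq_right (abs_nonneg _), mul_sub]
    have h2 : (φ0 z - φ0 u) ^ 2 ≤ CD ^ 2 * ∑ y ∈ T, w y * (σ y z - σ y u) ^ 2 := by
      have e : φ0 z - φ0 u = ∑ y ∈ T with (G.dist z y : ℝ) ≤ 2 * ρ, w y * (σ y z - σ y u) := by
        simp only [hφ0]
        rw [← Finset.sum_sub_distrib, Finset.sum_filter]
        refine Finset.sum_congr rfl fun y _ => ?_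
        split_ifs with hd
        · ring
        · obtain ⟨q1, q2⟩ := hfar y z u hk (not_le.mp hd)
          rw [q1, q2]; ring
      rw [e]
      refine (Finset.sum_sq_le_sum_mul_sum_of_sq_le_mul _ (f := w)
        (g := fun y => w y * (σ y z - σ y u) ^ 2) (fun y _ => hw0 y)
        (fun y _ => mul_nonneg (hw0 y) (sq_nonneg _)) (fun y _ => le_of_eq (by ring))).trans ?_
      apply mul_le_mul
      · apply wt_upper h hCD hVD z hρ0
        intro y hy; exact (Finset.mem_filter.mp hy).2
      · apply Finset.sum_le_sum_of_subset_of_nonneg (Finset.filter_subset _ _)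
        intro y _ _; exact mul_nonneg (hw0 y) (sq_nonneg _)
      · exact Finset.sum_nonneg fun y _ => mul_nonneg (hw0 y) (sq_nonneg _)
      · positivity
    calc (φ z - φ u) ^ 2 * K z u * pi z = (φ z - φ u) ^ 2 * (K z u * pi z) := by ring
      _ ≤ ((CD ^ 2) ^ 2 * (CD ^ 2 * ∑ y ∈ T, w y * (σ y z - σ y u) ^ 2)) * (K z u * pi z) := by
          apply mul_le_mul_of_nonneg_right _ hkp
          exact h1.trans (mul_le_mul_of_nonneg_left h2 (by positivity))
      _ = CD ^ 6 * ((∑ y ∈ T, w y * (σ y z - σ y u) ^ 2) * (K z u * pi z)) := by ring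
      _ = _ := by
          rw [Finset.sum_mul]
          congr 1
          refine Finset.sum_congr rfl fun y _ => by ring
  set A0 : Finset V := univ.filter (fun z => a - 1 < (G.dist x z : ℝ)) with hA0
  have hloc : ∑ z, f z ^ 2 * ∑ u, (φ z - φ u) ^ 2 * K z u * pi z
      = ∑ z ∈ A0, f z ^ 2 * ∑ u, (φ z - φ u) ^ 2 * K z u * pi z := by
    symm
    apply Finset.sum_subset (subset_univ _)
    intro z _ hz
    have hz' : (G.dist x z : ℝ) ≤ a - 1 := by
      by_contra hc
      exact hz (by rw [hA0, Finset.mem_filter]; exact ⟨mem_univ _, not_le.mp hc⟩)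
    have : ∑ u, (φ z - φ u) ^ 2 * K z u * pi z = 0 := by
      apply Finset.sum_eq_zero
      intro u _
      by_cases hk : K z u = 0
      · rw [hk]; simp
      have h1 := h.step hk
      have h2 := h.tri x z u
      rw [hone z (by linarith), hone u (by linarith)]; simp
    rw [this, mul_zero]
  set An := gball G x (a + 7 * ρ) \ gball G x (a - 5 * ρ) with hAn
  set T1 : Finset V := T.filter (fun y => a - 1 - 2 * ρ < (G.dist x y : ℝ)) with hT1
  have hnn : ∀ (g : V → ℝ) (z u : V), 0 ≤ (g z - g u) ^ 2 * K z u * pi z := fun g z u =>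
    mul_nonneg (mul_nonneg (sq_nonneg _) (h.nn z u)) (h.pos z).le
  have hT1A : ∀ y ∈ T1, gball G y (2 * ρ) ⊆ An := by
    intro y hy z hz
    obtain ⟨hy1, hy2⟩ := Finset.mem_filter.mp hy
    rw [hT] at hy1
    rw [hAn, Finset.mem_sdiff]
    rw [mem_gball'] at *
    rw [mem_gball']
    have t1 := h.tri x y z
    have t2 := h.tri x z y
    rw [MK.sdist z y] at t2
    constructor
    · linarith
    · intro hc; linarith
  calc _ = ∑ z ∈ A0, f z ^ 2 * ∑ u, (φ z - φ u) ^ 2 * K z u * pi z := hloc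
    _ ≤ ∑ z ∈ A0, f z ^ 2 * ∑ u, CD ^ 6 * ∑ y ∈ T, w y * ((σ y z - σ y u) ^ 2 * K z u * pi z) := by
        refine Finset.sum_le_sum fun z _ => mul_le_mul_of_nonneg_left ?_ (sq_nonneg _)
        exact Finset.sum_le_sum fun u _ => hpt z u
    _ = CD ^ 6 * ∑ y ∈ T, w y * ∑ z ∈ A0, f z ^ 2 *
          ∑ u, (σ y z - σ y u) ^ 2 * K z u * pi z := by
        simp_rw [Finset.mul_sum]
        rw [Finset.sum_comm (s := T)]
        refine Finset.sum_congr rfl fun z _ => ?_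
        rw [Finset.sum_comm]
        refine Finset.sum_congr rfl fun y _ => Finset.sum_congr rfl fun u _ => by ring
    _ ≤ CD ^ 6 * ∑ y ∈ T1, w y * ((3 * C2 + 2) * (en K pi (gball G y (2 * ρ)) f
          + ρ ^ (-θ) * ∑ z ∈ gball G y (2 * ρ), f z ^ 2 * pi z)) := by
        apply mul_le_mul_of_nonneg_left _ (by positivity)
        rw [hT1, Finset.sum_filter]
        refine Finset.sum_le_sum fun y _ => ?_
        split_ifs with hy
        · apply mul_le_mul_of_nonneg_left _ (hw0 y)
          refine le_trans ?_ (s3 y f)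
          apply Finset.sum_le_sum_of_subset_of_nonneg (subset_univ _)
          intro z _ _
          exact mul_nonneg (sq_nonneg _) (Finset.sum_nonneg fun u _ => hnn _ z u)
        · apply le_of_eq
          have : ∑ z ∈ A0, f z ^ 2 * ∑ u, (σ y z - σ y u) ^ 2 * K z u * pi z = 0 := by
            apply Finset.sum_eq_zero
            intro z hz
            have hz' := (Finset.mem_filter.mp hz).2
            have : ∑ u, (σ y z - σ y u) ^ 2 * K z u * pi z = 0 := by
              apply Finset.sum_eq_zero
              intro u _
              by_cases hk : K z u = 0
              · rw [hk]; simp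
              have t := h.tri x y z
              rw [MK.sdist y z] at t
              obtain ⟨q1, q2⟩ := hfar y z u hk (by linarith)
              rw [q1, q2]; simp
            rw [this, mul_zero]
          rw [this, mul_zero]
    _ = CD ^ 6 * (3 * C2 + 2) * (∑ y ∈ T1, w y * en K pi (gball G y (2 * ρ)) f
          + ρ ^ (-θ) * ∑ y ∈ T1, w y * ∑ z ∈ gball G y (2 * ρ), f z ^ 2 * pi z) := by
        rw [mul_assoc]
        congr 1
        rw [Finset.mul_sum (a := ρ ^ (-θ)), ← Finset.sum_add_distrib, Finset.mul_sum]
        refine Finset.sum_congr rfl fun y _ => by ring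
    _ ≤ CD ^ 6 * (3 * C2 + 2) * (CD ^ 2 * en K pi An f
          + ρ ^ (-θ) * (CD ^ 2 * ∑ z ∈ An, f z ^ 2 * pi z)) := by
        apply mul_le_mul_of_nonneg_left _ (by positivity)
        apply add_le_add
        · exact wt_avg h hCD hVD hρ0 le_rfl T1 An hT1A _ (hnn f)
        · apply mul_le_mul_of_nonneg_left _ (by positivity)
          exact wt_avg1 h hCD hVD hρ0 le_rfl T1 An hT1A _
            (fun z => mul_nonneg (sq_nonneg _) (h.pos z).le)
    _ = _ := by ring

/-- Caccioppoli inequality. -/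
theorem cacc {G : SimpleGraph V} {K : V → V → ℝ} {pi : V → ℝ} (h : MK G K pi)
    {l : ℝ} (hl : 0 < l) (v φ : V → ℝ) (B : Finset V) 
    (hv : ∀ z, φ z ≠ 0 → (1 + l) * v z = ∑ y, K z y * v y) (hB : ∀ z ∈ B, φ z = 1) :
    en K pi B v + l * ∑ z ∈ B, v z ^ 2 * pi z
      ≤ ∑ z, v z ^ 2 * ∑ u, (φ z - φ u) ^ 2 * K z u * pi z := by
  have hnn : ∀ (g : V → ℝ) (z u : V), 0 ≤ (g z - g u) ^ 2 * K z u * pi z := fun g z u =>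
    mul_nonneg (mul_nonneg (sq_nonneg _) (h.nn z u)) (h.pos z).le
  have h1 := green_id h v (fun z => v z * φ z ^ 2)
  have h2 : ∑ z, (v z * φ z ^ 2) * (v z - ∑ y, K z y * v y) * pi z
      = - l * ∑ z, (v z * φ z) ^ 2 * pi z := by
    rw [Finset.mul_sum]
    refine Finset.sum_congr rfl fun z _ => ?_
    by_cases hz : φ z = 0
    · rw [hz]; simp
    · rw [← hv z hz]; ring
  have h3 : ∑ z, ∑ y, (v z - v y) * (v z * φ z ^ 2 - v y * φ y ^ 2) * K z y * pi z
      = en K pi univ (fun z => v z * φ z)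
        - ∑ z, ∑ y, v z * v y * (φ z - φ y) ^ 2 * K z y * pi z := by
    unfold en
    rw [← Finset.sum_sub_distrib]
    refine Finset.sum_congr rfl fun z _ => ?_
    rw [← Finset.sum_sub_distrib]
    refine Finset.sum_congr rfl fun y _ => by ring
  have h4 : ∑ z, ∑ y, v z * v y * (φ z - φ y) ^ 2 * K z y * pi z
      ≤ ∑ z, v z ^ 2 * ∑ u, (φ z - φ u) ^ 2 * K z u * pi z := by
    have e1 : ∑ z, v z ^ 2 * ∑ u, (φ z - φ u) ^ 2 * K z u * pi z
        = ∑ z, ∑ u, v z ^ 2 * ((φ z - φ u) ^ 2 * K z u * pi z) := by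
      simp_rw [Finset.mul_sum]
    have e2 : ∑ z, ∑ u, v z ^ 2 * ((φ z - φ u) ^ 2 * K z u * pi z)
        = ∑ z, ∑ u, v u ^ 2 * ((φ z - φ u) ^ 2 * K z u * pi z) := by
      rw [Finset.sum_comm]
      refine Finset.sum_congr rfl fun z _ => Finset.sum_congr rfl fun u _ => ?_
      linear_combination (v u ^ 2 * (φ u - φ z) ^ 2) * h.rev u z
    have e3 : 2 * ∑ z, ∑ y, v z * v y * (φ z - φ y) ^ 2 * K z y * pi z
        ≤ ∑ z, ∑ u, v z ^ 2 * ((φ z - φ u) ^ 2 * K z u * pi z)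
          + ∑ z, ∑ u, v u ^ 2 * ((φ z - φ u) ^ 2 * K z u * pi z) := by
      rw [Finset.mul_sum, ← Finset.sum_add_distrib]
      refine Finset.sum_le_sum fun z _ => ?_
      rw [Finset.mul_sum, ← Finset.sum_add_distrib]
      refine Finset.sum_le_sum fun u _ => ?_
      have := hnn φ z u
      nlinarith [sq_nonneg (v z - v u)]
    rw [e1]
    linarith
  have h5 : en K pi B v ≤ en K pi univ (fun z => v z * φ z) := by
    unfold en
    calc _ = ∑ z ∈ B, ∑ y ∈ B, (v z * φ z - v y * φ y) ^ 2 * K z y * pi z := by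
          refine Finset.sum_congr rfl fun z hz => Finset.sum_congr rfl fun y hy => ?_
          rw [hB z hz, hB y hy, mul_one, mul_one]
      _ ≤ ∑ z ∈ B, ∑ y, (v z * φ z - v y * φ y) ^ 2 * K z y * pi z := by
          refine Finset.sum_le_sum fun z _ => ?_
          exact Finset.sum_le_sum_of_subset_of_nonneg (subset_univ _) fun y _ _ =>
            hnn (fun z => v z * φ z) z y
      _ ≤ _ := Finset.sum_le_sum_of_subset_of_nonneg (subset_univ _) fun z _ _ =>
            Finset.sum_nonneg fun y _ => hnn (fun z => v z * φ z) z y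
  have h6 : ∑ z ∈ B, v z ^ 2 * pi z ≤ ∑ z, (v z * φ z) ^ 2 * pi z := by
    calc _ = ∑ z ∈ B, (v z * φ z) ^ 2 * pi z := by
          refine Finset.sum_congr rfl fun z hz => ?_
          rw [hB z hz, mul_one]
      _ ≤ _ := Finset.sum_le_sum_of_subset_of_nonneg (subset_univ _) fun z _ _ =>
            mul_nonneg (sq_nonneg _) (h.pos z).le
  rw [h2, h3] at h1
  have h7 : 0 ≤ ∑ z ∈ B, v z ^ 2 * pi z := 
    Finset.sum_nonneg fun z _ => mul_nonneg (sq_nonneg _) (h.pos z).le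
  nlinarith

theorem en_sdiff {G : SimpleGraph V} {K : V → V → ℝ} {pi : V → ℝ} (h : MK G K pi)
    (S T : Finset V) (hST : S ⊆ T) (f : V → ℝ) :
    en K pi (T \ S) f + en K pi S f ≤ en K pi T f := by
  have hnn : ∀ (g : V → ℝ) (z u : V), 0 ≤ (g z - g u) ^ 2 * K z u * pi z := fun g z u =>
    mul_nonneg (mul_nonneg (sq_nonneg _) (h.nn z u)) (h.pos z).le
  unfold en
  rw [← Finset.sum_sdiff hST]
  apply add_le_add
  · exact Finset.sum_le_sum fun z _ => Finset.sum_le_sum_of_subset_of_nonneg Finset.sdiff_subset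
      fun u _ _ => hnn f z u
  · exact Finset.sum_le_sum fun z _ => Finset.sum_le_sum_of_subset_of_nonneg hST
      fun u _ _ => hnn f z u

/-- Hole filling step. -/
theorem hole {G : SimpleGraph V} {K : V → V → ℝ} {pi : V → ℝ} (h : MK G K pi)
    {θ C1 C2 ε CD : ℝ} (hCD : 0 < CD) (hVD : CondVD G pi CD) (hC2 : 0 < C2)
    (hCS : CondCS G K pi θ C1 C2 ε) (x : V) (b : ℝ) {ρ l : ℝ} (hρ : 1 ≤ ρ) (hl : 0 < l)
    (hlρ : ρ ^ (-θ) ≤ l) (v : V → ℝ) (hv1 : ∀ z, v z ^ 2 ≤ 1)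
    (hv : ∀ z ∈ gball G x (b + 7 * ρ), (1 + l) * v z = ∑ y, K z y * v y) :
    (en K pi (gball G x b) v + l * ∑ z ∈ gball G x b, v z ^ 2 * pi z
      ≤ (CD ^ 8 * (3 * C2 + 2)) *
      ((en K pi (gball G x (b + 12 * ρ)) v + l * ∑ z ∈ gball G x (b + 12 * ρ), v z ^ 2 * pi z) -
       (en K pi (gball G x b) v + l * ∑ z ∈ gball G x b, v z ^ 2 * pi z))) ∧
    (en K pi (gball G x b) v + l * ∑ z ∈ gball G x b, v z ^ 2 * pi z
      ≤ (CD ^ 8 * (3 * C2 + 2)) * (ρ ^ (-θ) * vol G pi x (b + 12 * ρ))) := by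
  have hρ0 : 0 < ρ := by linarith
  obtain ⟨φ, p0, p1, p2, p3⟩ := shell h hCD hVD hC2 hCS x (b + 5 * ρ) hρ
  have hc := cacc h hl v φ (gball G x b) (by
    intro z hz
    apply hv
    rw [mem_gball']
    by_contra hd
    push Not at hd
    exact hz (p2 z (by linarith))) (by
    intro z hz
    rw [mem_gball'] at hz
    exact p1 z (by linarith))
  have e1 : b + 5 * ρ + 7 * ρ = b + 12 * ρ := by ring
  have e2 : b + 5 * ρ - 5 * ρ = b := by ring
  rw [e1, e2] at p3
  have hsub : gball G x b ⊆ gball G x (b + 12 * ρ) := by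
    intro z hz; rw [mem_gball'] at *; linarith
  have hC : 0 ≤ CD ^ 8 * (3 * C2 + 2) := by positivity
  constructor
  · refine hc.trans ((p3 v).trans ?_)
    apply mul_le_mul_of_nonneg_left _ hC
    have s1 := en_sdiff h _ _ hsub v
    have s2 := Finset.sum_sdiff hsub (f := fun z => v z ^ 2 * pi z)
    have s3 : 0 ≤ ∑ z ∈ gball G x (b + 12 * ρ) \ gball G x b, v z ^ 2 * pi z :=
      Finset.sum_nonneg fun z _ => mul_nonneg (sq_nonneg _) (h.pos z).le
    have s4 := mul_le_mul_of_nonneg_right hlρ s3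
    have s5 : l * ∑ z ∈ gball G x (b + 12 * ρ), v z ^ 2 * pi z
        = l * (∑ z ∈ gball G x (b + 12 * ρ) \ gball G x b, v z ^ 2 * pi z)
          + l * ∑ z ∈ gball G x b, v z ^ 2 * pi z := by rw [← s2, mul_add]
    linarith
  · refine hc.trans (le_trans (b := ∑ z, (fun _ => (1:ℝ)) z ^ 2 *
        ∑ u, (φ z - φ u) ^ 2 * K z u * pi z) ?_ ((p3 (fun _ => 1)).trans ?_))
    · refine Finset.sum_le_sum fun z _ => ?_
      apply mul_le_mul_of_nonneg_right
      · simpa using hv1 z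
      · exact Finset.sum_nonneg fun u _ =>
          mul_nonneg (mul_nonneg (sq_nonneg _) (h.nn z u)) (h.pos z).le
    · apply mul_le_mul_of_nonneg_left _ hC
      have : en K pi (gball G x (b + 12 * ρ) \ gball G x b) (fun _ => (1:ℝ)) = 0 := by
        simp [en]
      rw [this, zero_add]
      apply mul_le_mul_of_nonneg_left _ (by positivity)
      simp only [one_pow, one_mul]
      exact Finset.sum_le_sum_of_subset_of_nonneg Finset.sdiff_subset fun z _ _ => (h.pos z).le

/-- Exponential decay of the L2 norm. -/
theorem decay {G : SimpleGraph V} {K : V → V → ℝ} {pi : V → ℝ} (h : MK G K pi)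
    {θ C1 C2 ε CD : ℝ} (hCD : 0 < CD) (hVD : CondVD G pi CD) (hC2 : 0 < C2)
    (hCS : CondCS G K pi θ C1 C2 ε) (x : V) {ρ l R : ℝ} (hρ : 1 ≤ ρ) (hl : 0 < l)
    (hlρ : ρ ^ (-θ) ≤ l) (v : V → ℝ) (hv1 : ∀ z, v z ^ 2 ≤ 1)
    (hv : ∀ z ∈ gball G x R, (1 + l) * v z = ∑ y, K z y * v y)
    {Cs : ℝ} (hCs : Cs = CD ^ 8 * (3 * C2 + 2)) (n : ℕ) :
    ∀ b : ℝ, b + 12 * (n + 1) * ρ ≤ R →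
    en K pi (gball G x b) v + l * ∑ z ∈ gball G x b, v z ^ 2 * pi z
      ≤ (Cs / (1 + Cs)) ^ n * (Cs * (ρ ^ (-θ) * vol G pi x R)) := by
  have hCs0 : 0 < Cs := by rw [hCs]; positivity
  have hρ0 : 0 < ρ := by linarith
  have hsubv : ∀ b, b + 12 * ρ ≤ R →
      ∀ z ∈ gball G x (b + 7 * ρ), (1 + l) * v z = ∑ y, K z y * v y := by
    intro b hb z hz
    apply hv
    rw [mem_gball'] at *
    linarith
  induction n with
  | zero =>
    intro b hb
    have hb' : b + 12 * ρ ≤ R := by simpa using hb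
    have := (hole h hCD hVD hC2 hCS x b hρ hl hlρ v hv1 (hsubv b hb')).2
    rw [← hCs] at this
    rw [pow_zero, one_mul]
    refine this.trans ?_
    apply mul_le_mul_of_nonneg_left _ hCs0.le
    apply mul_le_mul_of_nonneg_left _ (by positivity)
    apply vol_mono h
    simpa using hb'
  | succ n ih =>
    intro b hb
    push_cast at hb
    have hn : (0:ℝ) ≤ n * ρ := by positivity
    have hb' : b + 12 * ρ ≤ R := by nlinarith
    have h1 := (hole h hCD hVD hC2 hCS x b hρ hl hlρ v hv1 (hsubv b hb')).1
    rw [← hCs] at h1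
    have h2 := ih (b + 12 * ρ) (by linarith)
    set Fb := en K pi (gball G x b) v + l * ∑ z ∈ gball G x b, v z ^ 2 * pi z
    set Fb' := en K pi (gball G x (b + 12 * ρ)) v
      + l * ∑ z ∈ gball G x (b + 12 * ρ), v z ^ 2 * pi z
    have h3 : Fb ≤ Cs / (1 + Cs) * Fb' := by
      rw [div_mul_eq_mul_div, le_div_iff₀ (by linarith)]
      linarith
    calc Fb ≤ _ := h3
      _ ≤ Cs / (1 + Cs) * ((Cs / (1 + Cs)) ^ n * (Cs * (ρ ^ (-θ) * vol G pi x R))) := by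
          apply mul_le_mul_of_nonneg_left h2 (by positivity)
      _ = _ := by ring

/-- `v` is the discounted exit function of the ball. -/
def Sol (G : SimpleGraph V) (K : V → V → ℝ) (x : V) (r l : ℝ) (v : V → ℝ) : Prop :=
  (∀ z ∈ gball G x r, (1 + l) * v z = ∑ y, K z y * v y) ∧ ∀ z, z ∉ gball G x r → v z = 1

theorem sol_exists {G : SimpleGraph V} {K : V → V → ℝ} {pi : V → ℝ} (h : MK G K pi) {l : ℝ}
    (hl : 0 < l) (x : V) (r : ℝ) : ∃ v, Sol G K x r l v := by
  obtain ⟨v, h1, h2⟩ := h.solve hl (gball G x r) (fun z => if z ∈ gball G x r then 0 else 1)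
  refine ⟨v, fun z hz => ?_, fun z hz => ?_⟩
  · rw [h1 z hz, if_pos hz, add_zero]
  · rw [h2 z hz, if_neg hz]

theorem sol_nonneg {G : SimpleGraph V} {K : V → V → ℝ} {pi : V → ℝ} (h : MK G K pi) {l : ℝ}
    (hl : 0 < l) {x : V} {r : ℝ} {v : V → ℝ} (hv : Sol G K x r l v) (z : V) : 0 ≤ v z := by
  have := h.maxp hl (gball G x r) univ (fun z => - v z) (by
    intro z hz
    have := hv.1 z hz
    simp only [mul_neg, Finset.sum_neg_distrib]
    linarith) (by simp) (by
    intro z _ hz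
    rw [hv.2 z hz]; norm_num) z (mem_univ _)
  linarith

theorem sol_le_one {G : SimpleGraph V} {K : V → V → ℝ} {pi : V → ℝ} (h : MK G K pi) {l : ℝ}
    (hl : 0 < l) {x : V} {r : ℝ} {v : V → ℝ} (hv : Sol G K x r l v) (z : V) : v z ≤ 1 := by
  have := h.maxp hl (gball G x r) univ (fun z => v z - 1) (by
    intro z hz
    have := hv.1 z hz
    simp only [mul_sub, Finset.sum_sub_distrib, mul_one, h.sum1]
    linarith) (by simp) (by
    intro z _ hz
    rw [hv.2 z hz]; norm_num) z (mem_univ _)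
  linarith

/-- Comparison of different discount rates, via Jensen. -/
theorem sol_pow {G : SimpleGraph V} {K : V → V → ℝ} {pi : V → ℝ} (h : MK G K pi) {l l' p : ℝ}
    (hl : 0 < l) (hl' : 0 < l') (hp0 : 0 < p) (hp1 : p ≤ 1) (hll : p * l' = l)
    {x y : V} {r r' : ℝ} {v u : V → ℝ} (hv : Sol G K x r l v) (hu : Sol G K y r' l' u)
    (hsub : gball G y r' ⊆ gball G x r) (z : V) : v z ≤ u z ^ p := by
  have hu0 := sol_nonneg h hl' hu
  have := h.maxp hl (gball G y r') univ (fun z => v z - u z ^ p) (by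
    intro z hz
    have h1 := hv.1 z (hsub hz)
    have h2 := hu.1 z hz
    have hj : ∑ y, K z y * u y ^ p ≤ (∑ y, K z y * u y) ^ p := by
      have := (Real.concaveOn_rpow hp0.le hp1).le_map_sum (t := univ) (w := fun y => K z y)
        (p := u) (fun i _ => h.nn z i) (h.sum1 z) (fun i _ => hu0 i)
      simpa [smul_eq_mul] using this
    have hb := rpow_one_add_le_one_add_mul_self (s := l') (by linarith) hp0.le hp1
    rw [← h2, Real.mul_rpow (by linarith) (hu0 z)] at hj
    rw [hll] at hb
    have hk := mul_le_mul_of_nonneg_right hb (Real.rpow_nonneg (hu0 z) p)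
    simp only [mul_sub, Finset.sum_sub_distrib]
    linarith) (by simp) (by
    intro z _ hz
    rw [hu.2 z hz, Real.one_rpow]
    linarith [sol_le_one h hl hv z]) z (mem_univ _)
  linarith

set_option maxHeartbeats 1000000 in
/-- Core estimate: the discounted exit function is small at the centre. -/
theorem core {G : SimpleGraph V} {K : V → V → ℝ} {pi : V → ℝ} (h : MK G K pi)
    {θ C1 C2 ε CD CP : ℝ} (hθ : 2 ≤ θ) (hCD : 2 ≤ CD) (hVD : CondVD G pi CD) (hC2 : 0 < C2)
    (hCS : CondCS G K pi θ C1 C2 ε) (hCP : 0 < CP) (hPI : CondPI G K pi θ CP)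
    {m A Cs : ℝ} (hm0 : 0 < m) (hm1 : m ≤ 1) (hmp : m ^ (1 / (4:ℝ) ^ θ) ≤ 1 / 4) {n k : ℕ}
    (hA : A = (16 * ((n:ℝ) + 1)) ^ θ / m) (hCs : Cs = CD ^ 8 * (3 * C2 + 2))
    (hi : (2 * CD ^ (k + 2)) * ((16 / m ^ 2) * ((Cs / (1 + Cs)) ^ n * Cs)) ≤ 1)
    (hii : (4:ℝ) ^ θ * A * (2 * (4 * CD ^ 5 * CP * (1 / 2 ^ k) ^ θ)) ≤ m) (j : ℕ) :
    ∀ r : ℝ, 0 < r → r ≤ 4 ^ j * (16 * ((n:ℝ) + 1)) → ∀ (x : V) (v : V → ℝ),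
      Sol G K x r (A / r ^ θ) v → v x ≤ m := by
  have hCD0 : 0 < CD := by linarith
  have hn0 : (0:ℝ) < 16 * ((n:ℝ) + 1) := by positivity
  have hA0 : 0 < A := by rw [hA]; positivity
  have hCs0 : 0 < Cs := by rw [hCs]; positivity
  have base : ∀ r : ℝ, 0 < r → r ≤ 16 * ((n:ℝ) + 1) → ∀ (x : V) (v : V → ℝ),
      Sol G K x r (A / r ^ θ) v → v x ≤ m := by
    intro r hr hr2 x v hv
    have hl : 0 < A / r ^ θ := by positivity
    have h1 := hv.1 x (by rw [mem_gball']; simpa using hr.le)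
    have h2 : ∑ y, K x y * v y ≤ 1 := by
      rw [← h.sum1 x]
      refine Finset.sum_le_sum fun y _ => ?_
      have := mul_le_mul_of_nonneg_left (sol_le_one h hl hv y) (h.nn x y)
      linarith
    have h3 : 1 / m ≤ A / r ^ θ := by
      rw [hA, div_div, div_le_div_iff₀ hm0 (by positivity)]
      have := Real.rpow_le_rpow hr.le hr2 (by linarith : 0 ≤ θ)
      nlinarith
    have h4 := sol_nonneg h hl hv x
    have h5 : 1 / m * v x ≤ 1 := by
      have := mul_le_mul_of_nonneg_right h3 h4
      nlinarith
    rw [div_mul_eq_mul_div, one_mul, div_le_one hm0] at h5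
    exact h5
  induction j with
  | zero => intro r hr hr2; exact base r hr (by simpa using hr2)
  | succ j ih =>
    intro r hr hr2 x v hv
    by_cases hr3 : r ≤ 16 * ((n:ℝ) + 1)
    · exact base r hr hr3 x v hv
    push Not at hr3
    set l := A / r ^ θ with hl_def
    have hrθ : 0 < r ^ θ := by positivity
    have hl : 0 < l := by positivity
    have h4θ : 0 < (4:ℝ) ^ θ := by positivity
    have hr4 : 0 < r / 4 := by positivity
    have hr16 : 16 < r := by
      have : (0:ℝ) ≤ n := Nat.cast_nonneg n
      linarith
    have hl'eq : A / (r / 4) ^ θ = 4 ^ θ * l := by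
      rw [Real.div_rpow hr.le (by norm_num), hl_def]
      field_simp
    set l' := A / (r / 4) ^ θ with hl'_def
    have hl' : 0 < l' := by positivity
    have hll : 1 / (4:ℝ) ^ θ * l' = l := by rw [hl'eq]; field_simp
    have hv0 := sol_nonneg h hl hv
    have hv1 := sol_le_one h hl hv
    have ihr := ih (r / 4) hr4 (by rw [pow_succ] at hr2; linarith)
    -- interior bound
    have hq : ∀ y, (G.dist x y : ℝ) ≤ r / 4 + 1 → v y ≤ 1 / 4 := by
      intro y hy
      obtain ⟨u, hu⟩ := sol_exists h hl' y (r / 4)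
      have h1 := sol_pow h hl hl' (p := 1 / (4:ℝ) ^ θ) (by positivity) (by
        rw [div_le_one h4θ]
        exact Real.one_le_rpow (by norm_num) (by linarith)) hll hv hu (by
        intro z hz
        rw [mem_gball'] at *
        have := h.tri x y z
        linarith) y
      have h2 := ihr y u hu
      have h3 := Real.rpow_le_rpow (sol_nonneg h hl' hu y) h2
        (by positivity : 0 ≤ 1 / (4:ℝ) ^ θ)
      linarith
    -- decay
    set ρ := r / (16 * ((n:ℝ) + 1)) with hρ_def
    have hρ1 : 1 ≤ ρ := by rw [hρ_def, le_div_iff₀ hn0]; linarith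
    have hρl : ρ ^ (-θ) ≤ l := by
      rw [Real.rpow_neg (by linarith), hρ_def, Real.div_rpow hr.le hn0.le, inv_div, hl_def]
      apply div_le_div_of_nonneg_right _ hrθ.le
      rw [hA, le_div_iff₀ hm0]
      have : 0 < (16 * ((n:ℝ) + 1)) ^ θ := by positivity
      nlinarith
    have hd := decay h hCD0 hVD hC2 hCS x hρ1 hl hρl v (by
      intro z
      have := hv0 z
      have := hv1 z
      nlinarith) hv.1 hCs n (r / 4) (by
      have : (n + 1) * ρ = r / 16 := by rw [hρ_def]; field_simp
      linarith)
    have hen := en_nonneg h (gball G x (r / 4)) v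
    have hvol := vol_pos h (x := x) hr.le
    have hd2 : ∑ z ∈ gball G x (r / 4), v z ^ 2 * pi z
        ≤ (Cs / (1 + Cs)) ^ n * Cs * vol G pi x r := by
      have h1 : (Cs / (1 + Cs)) ^ n * (Cs * (ρ ^ (-θ) * vol G pi x r))
          ≤ (Cs / (1 + Cs)) ^ n * (Cs * (l * vol G pi x r)) := by gcongr
      have h2 : l * ∑ z ∈ gball G x (r / 4), v z ^ 2 * pi z
          ≤ l * ((Cs / (1 + Cs)) ^ n * Cs * vol G pi x r) := by
        calc _ ≤ (Cs / (1 + Cs)) ^ n * (Cs * (l * vol G pi x r)) := by linarith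
          _ = _ := by ring
      exact le_of_mul_le_mul_left h2 hl
    -- the bad set
    set U := (gball G x (r / 4)).filter (fun z => m / 4 < v z) with hU
    have hUsub : U ⊆ gball G x (r / 4) := Finset.filter_subset _ _
    have hUr : U ⊆ gball G x r := by
      intro z hz
      have := hUsub hz
      rw [mem_gball'] at *
      linarith
    have hUm : (m / 4) ^ 2 * ∑ z ∈ U, pi z ≤ ∑ z ∈ gball G x (r / 4), v z ^ 2 * pi z := by
      rw [Finset.mul_sum]
      refine le_trans (Finset.sum_le_sum fun z hz => ?_)
        (Finset.sum_le_sum_of_subset_of_nonneg hUsub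
          fun z _ _ => mul_nonneg (sq_nonneg _) (h.pos z).le)
      apply mul_le_mul_of_nonneg_right _ (h.pos z).le
      have := (Finset.mem_filter.mp hz).2
      nlinarith
    have hUv : (2 * CD ^ (k + 2)) * ∑ z ∈ U, pi z ≤ vol G pi x r := by
      have h1 : ∑ z ∈ U, pi z ≤ (16 / m ^ 2) * ((Cs / (1 + Cs)) ^ n * Cs * vol G pi x r) := by
        rw [div_mul_eq_mul_div, le_div_iff₀ (by positivity)]
        linarith
      calc _ ≤ (2 * CD ^ (k + 2)) *
            ((16 / m ^ 2) * ((Cs / (1 + Cs)) ^ n * Cs * vol G pi x r)) := by gcongr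
        _ = ((2 * CD ^ (k + 2)) * ((16 / m ^ 2) * ((Cs / (1 + Cs)) ^ n * Cs)))
            * vol G pi x r := by ring
        _ ≤ 1 * vol G pi x r := mul_le_mul_of_nonneg_right hi hvol.le
        _ = _ := one_mul _
    obtain ⟨w, hw1, hw2⟩ := h.solve hl U (fun z => if z ∈ U then 1 else 0)
    have hwU : ∀ z ∈ U, (1 + l) * w z = ∑ y, K z y * w y + 1 := by
      intro z hz; rw [hw1 z hz, if_pos hz]
    have hwo : ∀ z, z ∉ U → w z = 0 := by
      intro z hz; rw [hw2 z hz, if_neg hz]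
    have hw0 : ∀ z, 0 ≤ w z := by
      intro z
      have := h.maxp hl U univ (fun z => - w z) (by
        intro z hz
        have := hwU z hz
        simp only [mul_neg, Finset.sum_neg_distrib]
        linarith) (by simp) (by
        intro z _ hz
        rw [hwo z hz]; norm_num) z (mem_univ _)
      linarith
    have hws := supw h hθ hCD hVD hCP hPI hl U w hw0 hwU hwo x hr hUr k hUv x
    obtain ⟨u, hu⟩ := sol_exists h hl' x (r / 4)
    have hu0 := sol_nonneg h hl' hu
    have hu1 := sol_le_one h hl' hu
    have hux := ihr x u hu
    have hfin := h.maxp hl U (gball G x (r / 4 + 1))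
      (fun z => v z - (m / 4 + u z / 4 + l' / 4 * w z)) (by
      intro z hz
      have e1 := hv.1 z (hUr hz)
      have e2 := hu.1 z (hUsub hz)
      have e3 := hwU z hz
      have e4 : ∑ y, K z y * (v y - (m / 4 + u y / 4 + l' / 4 * w y))
          = ∑ y, K z y * v y - (m / 4 + (∑ y, K z y * u y) / 4
            + l' / 4 * ∑ y, K z y * w y) := by
        have : m / 4 = ∑ y, K z y * (m / 4) := by rw [← Finset.sum_mul, h.sum1, one_mul]
        rw [this, Finset.sum_div, Finset.mul_sum, ← Finset.sum_add_distrib,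
          ← Finset.sum_add_distrib, ← Finset.sum_sub_distrib]
        refine Finset.sum_congr rfl fun y _ => ?_
        rw [← this]
        ring
      rw [e4, ← e1, ← e2]
      have e5 : ∑ y, K z y * w y = (1 + l) * w z - 1 := by linarith
      rw [e5]
      have e6 : l' * u z ≤ l' := mul_le_of_le_one_right hl'.le (hu1 z)
      have e7 : 0 ≤ l * u z := mul_nonneg hl.le (hu0 z)
      have e8 : 0 ≤ l * m := mul_nonneg hl.le hm0.le
      linarith) (by
      intro z hz y hy
      have h1 := hUsub hz
      rw [mem_gball'] at *
      have := h.tri x z y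
      have := h.step hy
      linarith) (by
      intro z hz hzU
      have hz' := hq z (mem_gball'.mp hz)
      have hwz := mul_nonneg (by positivity : 0 ≤ l' / 4) (hw0 z)
      by_cases hzb : z ∈ gball G x (r / 4)
      · have : v z ≤ m / 4 := by
          by_contra hc
          exact hzU (Finset.mem_filter.mpr ⟨hzb, not_le.mp hc⟩)
        linarith [hu0 z]
      · rw [hu.2 z hzb]
        linarith) x (by rw [mem_gball']; simp; linarith)
    have hlw : l' * w x ≤ m := by
      refine le_trans (mul_le_mul_of_nonneg_left hws hl'.le) (le_trans (le_of_eq ?_) hii)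
      rw [hl'eq, hl_def, div_eq_mul_one_div r, Real.mul_rpow hr.le (by positivity)]
      field_simp
    linarith

theorem chain {G : SimpleGraph V} {K : V → V → ℝ} {pi : V → ℝ} (h : MK G K pi)
    {l m r R : ℝ} (hl : 0 < l) (hr : 0 < r) (hm : 0 ≤ m)
    (hc : ∀ (x : V) (v : V → ℝ), Sol G K x r l v → v x ≤ m) {x : V} {v : V → ℝ}
    (hv : Sol G K x R l v) (j : ℕ) :
    ∀ y, (G.dist x y : ℝ) + j * (r + 1) ≤ R → v y ≤ m ^ j := by
  induction j with
  | zero => intro y _; simpa using sol_le_one h hl hv y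
  | succ j ih =>
    intro y hy
    push_cast at hy
    obtain ⟨u, hu⟩ := sol_exists h hl y r
    have hj : (0:ℝ) ≤ j * (r + 1) := by positivity
    have hsub : gball G y r ⊆ gball G x R := by
      intro z hz
      rw [mem_gball'] at *
      have := h.tri x y z
      linarith
    have := h.maxp hl (gball G y r) (gball G y (r + 1)) (fun z => v z - m ^ j * u z) (by
      intro z hz
      have e1 := hv.1 z (hsub hz)
      have e2 := hu.1 z hz
      have e3 : ∑ y, K z y * (v y - m ^ j * u y)
          = ∑ y, K z y * v y - m ^ j * ∑ y, K z y * u y := by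
        rw [Finset.mul_sum, ← Finset.sum_sub_distrib]
        exact Finset.sum_congr rfl fun y _ => by ring
      rw [e3, ← e1, ← e2]
      apply le_of_eq; ring) (by
      intro z hz y' hy'
      rw [mem_gball'] at *
      have := h.tri y z y'
      have := h.step hy'
      linarith) (by
      intro z hz hzU
      rw [mem_gball'] at hz
      rw [hu.2 z hzU]
      have := ih z (by
        have := h.tri x y z
        linarith)
      linarith) y (by rw [mem_gball']; simp; linarith)
    have h2 := mul_le_mul_of_nonneg_left (hc y u hu) (pow_nonneg hm j)
    rw [pow_succ]
    linarith

theorem matpow_nonneg {G : SimpleGraph V} {K : V → V → ℝ} {pi : V → ℝ} (h : MK G K pi)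
    (n : ℕ) : ∀ x y, 0 ≤ matpow K n x y := by
  induction n with
  | zero => intro x y; simp only [matpow]; split_ifs <;> norm_num
  | succ n ih =>
    intro x y
    simp only [matpow]
    exact Finset.sum_nonneg fun z _ => mul_nonneg (h.nn x z) (ih z y)

theorem matpow_dist {G : SimpleGraph V} {K : V → V → ℝ} {pi : V → ℝ} (h : MK G K pi)
    (n : ℕ) : ∀ x y, matpow K n x y ≠ 0 → (G.dist x y : ℝ) ≤ n := by
  induction n with
  | zero =>
    intro x y hxy
    by_cases he : x = y
    · subst he; simp
    · simp [matpow, he] at hxy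
  | succ n ih =>
    intro x y hxy
    simp only [matpow] at hxy
    obtain ⟨z, _, hz⟩ := Finset.exists_ne_zero_of_sum_ne_zero hxy
    have h1 := h.step (left_ne_zero_of_mul hz)
    have h2 := ih z y (right_ne_zero_of_mul hz)
    have := h.tri x z y
    push_cast
    linarith

theorem matpow_super {G : SimpleGraph V} {K : V → V → ℝ} {pi : V → ℝ} (h : MK G K pi)
    {a : ℝ} (ha : 0 ≤ a) (v : V → ℝ) (hv : ∀ z, ∑ y, K z y * v y ≤ a * v z)
    (n : ℕ) : ∀ x, ∑ y, matpow K n x y * v y ≤ a ^ n * v x := by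
  induction n with
  | zero => intro x; simp [matpow]
  | succ n ih =>
    intro x
    have e : ∑ y, matpow K (n + 1) x y * v y
        = ∑ z, K x z * ∑ y, matpow K n z y * v y := by
      simp only [matpow, Finset.sum_mul, Finset.mul_sum]
      rw [Finset.sum_comm]
      exact Finset.sum_congr rfl fun _ _ => Finset.sum_congr rfl fun _ _ => by ring
    rw [e]
    calc _ ≤ ∑ z, K x z * (a ^ n * v z) :=
          Finset.sum_le_sum fun z _ => mul_le_mul_of_nonneg_left (ih z) (h.nn x z)
      _ = a ^ n * ∑ z, K x z * v z := by
          rw [Finset.mul_sum]; exact Finset.sum_congr rfl fun _ _ => by ring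
      _ ≤ a ^ n * (a * v x) := mul_le_mul_of_nonneg_left (hv x) (pow_nonneg ha n)
      _ = _ := by ring

theorem probGt_zero {G : SimpleGraph V} {K : V → V → ℝ} {pi : V → ℝ} (h : MK G K pi)
    (x : V) (s : ℕ) (R : ℝ) (hR : (s:ℝ) ≤ R) : probGt G K x s R = 0 := by
  unfold probGt
  refine Finset.sum_eq_zero fun y hy => ?_
  by_contra hc
  have := matpow_dist h s x y hc
  have := (Finset.mem_filter.mp hy).2
  linarith

theorem probGt_le_one {G : SimpleGraph V} {K : V → V → ℝ} {pi : V → ℝ} (h : MK G K pi)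
    (x : V) (s : ℕ) (R : ℝ) : probGt G K x s R ≤ 1 := by
  have := matpow_super h (a := 1) zero_le_one (fun _ => 1) (by
    intro z; simp [h.sum1]) s x
  simp only [mul_one, one_pow] at this
  refine le_trans ?_ this
  exact Finset.sum_le_sum_of_subset_of_nonneg (Finset.filter_subset _ _)
    fun y _ _ => matpow_nonneg h s x y

theorem probGt_sol {G : SimpleGraph V} {K : V → V → ℝ} {pi : V → ℝ} (h : MK G K pi)
    {l : ℝ} (hl : 0 < l) (x : V) (s : ℕ) (R : ℝ) {v : V → ℝ} (hv : Sol G K x R l v) :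
    probGt G K x s R ≤ (1 + l) ^ s * v x := by
  have hv0 := sol_nonneg h hl hv
  have hv1 := sol_le_one h hl hv
  refine le_trans ?_ (matpow_super h (a := 1 + l) (by linarith) v (by
    intro z
    by_cases hz : z ∈ gball G x R
    · exact (hv.1 z hz).ge
    · rw [hv.2 z hz]
      have : ∑ y, K z y * v y ≤ ∑ y, K z y := by
        refine Finset.sum_le_sum fun y _ => ?_
        have := mul_le_mul_of_nonneg_left (hv1 y) (h.nn z y)
        linarith
      rw [h.sum1] at this
      linarith) s x)
  unfold probGt
  refine le_trans (le_of_eq (Finset.sum_congr rfl fun y hy => ?_))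
    (Finset.sum_le_sum_of_subset_of_nonneg (Finset.filter_subset _ _)
      fun y _ _ => mul_nonneg (matpow_nonneg h s x y) (hv0 y))
  have := (Finset.mem_filter.mp hy).2
  rw [hv.2 y (by rw [mem_gball']; linarith), mul_one]

theorem consts {θ CD CP C2 : ℝ} (hθ : 2 ≤ θ) (hCD : 2 ≤ CD) (hCP : 0 < CP) (hC2 : 0 < C2) :
    ∃ (m A Cs : ℝ) (n k : ℕ), 0 < m ∧ m < 1 ∧ m ^ (1 / (4:ℝ) ^ θ) ≤ 1 / 4 ∧
      A = (16 * ((n:ℝ) + 1)) ^ θ / m ∧ Cs = CD ^ 8 * (3 * C2 + 2) ∧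
      (2 * CD ^ (k + 2)) * ((16 / m ^ 2) * ((Cs / (1 + Cs)) ^ n * Cs)) ≤ 1 ∧
      (4:ℝ) ^ θ * A * (2 * (4 * CD ^ 5 * CP * (1 / 2 ^ k) ^ θ)) ≤ m := by
  have hCD0 : 0 < CD := by linarith
  set m : ℝ := (1 / 4) ^ ((4:ℝ) ^ θ) with hm
  have h4 : 0 < (4:ℝ) ^ θ := by positivity
  have hm0 : 0 < m := by positivity
  have hm1 : m < 1 := Real.rpow_lt_one (by norm_num) (by norm_num) h4
  have hmp : m ^ (1 / (4:ℝ) ^ θ) ≤ 1 / 4 := by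
    rw [hm, ← Real.rpow_mul (by norm_num), mul_one_div_cancel h4.ne', Real.rpow_one]
  set Cs := CD ^ 8 * (3 * C2 + 2) with hCs
  have hCs0 : 0 < Cs := by positivity
  set δ := Cs / (1 + Cs) with hδ
  have hδ0 : 0 < δ := by positivity
  have hδ1 : δ < 1 := by rw [hδ, div_lt_one (by linarith)]; linarith
  obtain ⟨i, hi⟩ := pow_unbounded_of_one_lt (64 * (8 * CD ^ 5 * CP) / m ^ 2 + 64)
    (by norm_num : (1:ℝ) < 2)
  obtain ⟨q, hq⟩ := pow_unbounded_of_one_lt CD (by norm_num : (1:ℝ) < 2)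
  have hT0 : 0 < 64 * (8 * CD ^ 5 * CP) / m ^ 2 := by positivity
  have ht := (tendsto_pow_const_mul_const_pow_of_abs_lt_one q
    (by rw [abs_of_pos hδ0]; exact hδ1 : |δ| < 1)).comp
    (tendsto_pow_atTop_atTop_of_one_lt (by norm_num : 1 < 2))
  set M := (2 * CD ^ (i + 2)) * ((16 / m ^ 2) * Cs) / δ with hM
  have hM0 : 0 < M := by positivity
  obtain ⟨j, hj⟩ := (ht.eventually (gt_mem_nhds (show (0:ℝ) < 1 / M by positivity))).exists
  simp only [Function.comp] at hj
  push_cast at hj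
  have h2j : 1 ≤ 2 ^ j := Nat.one_le_two_pow
  refine ⟨m, _, Cs, 2 ^ j - 1, j + i, hm0, hm1, hmp, rfl, rfl, ?_, ?_⟩
  · have e : δ ^ (2 ^ j - 1) = δ ^ (2 ^ j) / δ := by
      rw [eq_div_iff hδ0.ne', ← pow_succ, Nat.sub_add_cancel h2j]
    have e2 : CD ^ j ≤ ((2:ℝ) ^ j) ^ q := by
      rw [← pow_mul, mul_comm, pow_mul]
      exact pow_le_pow_left₀ hCD0.le hq.le j
    rw [e]
    calc _ = M * (CD ^ j * δ ^ 2 ^ j) := by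
          rw [hM]; field_simp; ring
      _ ≤ M * (((2:ℝ) ^ j) ^ q * δ ^ 2 ^ j) := by gcongr
      _ ≤ M * (1 / M) := by gcongr
      _ = 1 := by field_simp
  · rw [Nat.cast_sub h2j]
    push_cast
    rw [sub_add_cancel]
    have e1 : (4:ℝ) ^ θ * (16 * 2 ^ j) ^ θ * (1 / 2 ^ (j + i)) ^ θ = (64 / 2 ^ i) ^ θ := by
      rw [← Real.mul_rpow (by norm_num) (by positivity),
        ← Real.mul_rpow (by positivity) (by positivity)]
      congr 1
      rw [pow_add]; field_simp; norm_num
    have e2 : (64 / 2 ^ i : ℝ) ^ θ ≤ 64 / 2 ^ i := by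
      have h1 : (64 / 2 ^ i : ℝ) ≤ 1 := by
        rw [div_le_one (by positivity)]; linarith
      calc _ ≤ (64 / 2 ^ i : ℝ) ^ (1:ℝ) :=
            Real.rpow_le_rpow_of_exponent_ge (by positivity) h1 (by linarith)
        _ = _ := Real.rpow_one _
    have e3 : (64 / 2 ^ i : ℝ) * (8 * CD ^ 5 * CP) ≤ m ^ 2 := by
      have h1 : 64 * (8 * CD ^ 5 * CP) / m ^ 2 ≤ 2 ^ i := by linarith
      rw [div_le_iff₀ (by positivity)] at h1
      rw [div_mul_eq_mul_div, div_le_iff₀ (by positivity)]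
      linarith
    calc _ = ((4:ℝ) ^ θ * (16 * 2 ^ j) ^ θ * (1 / 2 ^ (j + i)) ^ θ) * (8 * CD ^ 5 * CP) / m := by
          ring
      _ = (64 / 2 ^ i : ℝ) ^ θ * (8 * CD ^ 5 * CP) / m := by rw [e1]
      _ ≤ (64 / 2 ^ i : ℝ) * (8 * CD ^ 5 * CP) / m := by gcongr
      _ ≤ m ^ 2 / m := by gcongr
      _ = m := by field_simp

/-- Optimisation of the radius. -/
theorem optim {θ m A : ℝ} (hθ : 2 ≤ θ) (hm0 : 0 < m) (hm1 : m < 1) (hA : 0 < A) :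
    ∃ c > (0:ℝ), ∀ (R : ℝ), 0 < R → ∀ s : ℕ, R ≤ s → ∃ r > (0:ℝ), ∃ j : ℕ, j * (r + 1) ≤ R ∧
      (1 + A / r ^ θ) ^ s * m ^ j ≤ 1 / m * Real.exp (-(c * (R ^ θ / (s:ℝ)) ^ (1 / (θ - 1)))) := by
  set L := -Real.log m with hL
  have hL0 : 0 < L := by rw [hL]; linarith [Real.log_neg hm0 hm1]
  set B := max 1 (4 * A / L) with hB
  have hB1 : 1 ≤ B := le_max_left _ _
  have hB2 : 4 * A ≤ B * L := by
    have : 4 * A / L ≤ B := le_max_right _ _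
    rwa [div_le_iff₀ hL0] at this
  have hB0 : 0 < B := by linarith
  have hθ1 : 0 < θ - 1 := by linarith
  refine ⟨L / 4 * (B ^ (1 / (θ - 1)))⁻¹, by positivity, fun R hR s hs => ?_⟩
  have hs0 : (0:ℝ) < s := by linarith
  set r := (B * s / R) ^ (1 / (θ - 1)) with hr
  have hr1 : 1 ≤ r := by
    apply Real.one_le_rpow _ (by positivity)
    rw [le_div_iff₀ hR]; nlinarith
  have hr0 : 0 < r := by linarith
  have hrp : r ^ (θ - 1) = B * s / R := by
    rw [hr, ← Real.rpow_mul (by positivity), one_div_mul_cancel hθ1.ne', Real.rpow_one]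
  have hrθ : r ^ θ = B * s / R * r := by
    rw [← hrp, ← Real.rpow_add_one hr0.ne']; congr 1; ring
  refine ⟨r, hr0, ⌊R / (r + 1)⌋₊, ?_, ?_⟩
  · have := Nat.floor_le (show 0 ≤ R / (r + 1) by positivity)
    rwa [le_div_iff₀ (by linarith)] at this
  set j := ⌊R / (r + 1)⌋₊ with hj
  have hj1 : R / (2 * r) - 1 ≤ j := by
    have h1 := (Nat.lt_floor_add_one (R / (r + 1))).le
    have h2 : R / (2 * r) ≤ R / (r + 1) := by
      apply div_le_div_of_nonneg_left hR.le (by linarith) (by linarith)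
    linarith
  have hmj : m ^ j = Real.exp (-(L * j)) := by
    rw [hL, neg_mul, neg_neg, mul_comm, Real.exp_nat_mul, Real.exp_log hm0]
  have hminv : 1 / m = Real.exp L := by rw [hL, Real.exp_neg, Real.exp_log hm0, one_div]
  have hpow : (1 + A / r ^ θ) ^ s ≤ Real.exp (s * (A / r ^ θ)) := by
    rw [Real.exp_nat_mul]
    apply pow_le_pow_left₀ (by positivity)
    linarith [Real.add_one_le_exp (A / r ^ θ)]
  have hval : (R ^ θ / (s:ℝ)) ^ (1 / (θ - 1)) = B ^ (1 / (θ - 1)) * (R / r) := by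
    have e1 : R / r = (R ^ (θ - 1) * (R / (B * s))) ^ (1 / (θ - 1)) := by
      rw [Real.mul_rpow (by positivity) (by positivity), ← Real.rpow_mul hR.le,
        mul_one_div_cancel hθ1.ne', Real.rpow_one, hr, div_eq_mul_inv,
        ← Real.inv_rpow (by positivity), inv_div]
    rw [e1, ← Real.mul_rpow hB0.le (by positivity)]
    congr 1
    rw [show R ^ (θ - 1) * (R / (B * s)) = (R ^ (θ - 1) * R) / (B * s) by ring,
      ← Real.rpow_add_one hR.ne', sub_add_cancel]
    field_simp
  rw [hval, hmj, hminv, ← Real.exp_add]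
  refine le_trans (mul_le_mul_of_nonneg_right hpow (Real.exp_pos _).le) ?_
  rw [← Real.exp_add, Real.exp_le_exp]
  have hBne : B ^ (1 / (θ - 1)) ≠ 0 := by positivity
  have e1 : L / 4 * (B ^ (1 / (θ - 1)))⁻¹ * (B ^ (1 / (θ - 1)) * (R / r)) = L / 4 * (R / r) := by
    field_simp
  have e2 : s * (A / r ^ θ) ≤ L / 4 * (R / r) := by
    rw [hrθ, show s * (A / (B * s / R * r)) = A / B * (R / r) by field_simp]
    apply mul_le_mul_of_nonneg_right _ (by positivity)
    rw [div_le_iff₀ hB0]; linarith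
  have e3 : L * (R / (2 * r) - 1) ≤ L * j := mul_le_mul_of_nonneg_left hj1 hL0.le
  have e4 : L * (R / (2 * r) - 1) = L / 2 * (R / r) - L := by field_simp
  rw [e1]
  linarith

/-- For a Harnack graph, for every `x`, real `R ≥ 0` and integer `s ≥ 1`,
`P_x(d(x,X_s) > R) ≤ C exp(−c (R^θ/s)^{1/(θ−1)})`. -/
theorem stmt10 (θ p0 CD CP Ccs1 Ccs2 ε : ℝ) (hθ : 2 ≤ θ) :
    ∃ C > (0 : ℝ), ∃ c > (0 : ℝ),
      ∀ (V : Type) [Fintype V] [DecidableEq V],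
        ∀ (G : SimpleGraph V) (K : V → V → ℝ) (pi : V → ℝ),
          IsMarkovKernel G K pi → Harnack G K pi θ p0 CD CP Ccs1 Ccs2 ε →
          ∀ (x : V) (R : ℝ), 0 ≤ R → ∀ s : ℕ, 1 ≤ s →
            probGt G K x s R ≤
              C * Real.exp (-(c * (R ^ θ / (s : ℝ)) ^ (1 / (θ - 1)))) := by
  by_cases hpos : 0 < CP ∧ 0 < Ccs2
  swap
  · refine ⟨1, one_pos, 1, one_pos, ?_⟩
    intro V _ _ G K pi _ hH
    exact absurd ⟨hH.2.2.1, hH.2.2.2.2.1⟩ hpos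
  obtain ⟨hCP, hC2⟩ := hpos
  obtain ⟨m, A, Cs, n, k, hm0, hm1, hmp, hA, hCs, hi, hii⟩ :=
    consts hθ (le_max_right CD 2) hCP hC2
  have hA0 : 0 < A := by rw [hA]; positivity
  obtain ⟨c, hc0, hc⟩ := optim hθ hm0 hm1 hA0
  refine ⟨1 / m, by positivity, c, hc0, ?_⟩
  intro V _ _ G K pi hK hH x R hR s hs
  have h : MK G K pi := ⟨hK.1, hK.2.1, hK.2.2.1, hK.2.2.2.1, hK.2.2.2.2.2.1, hK.2.2.2.2.2.2.2.1⟩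
  obtain ⟨-, -, -, -, -, -, -, hVD, hPI, hCS⟩ := hH
  have hVD2 : CondVD G pi (max CD 2) := by
    intro y t ht
    refine (hVD y t ht).trans ?_
    exact mul_le_mul_of_nonneg_right (le_max_left _ _) (vol_pos h ht.le).le
  rcases le_or_gt (s:ℝ) R with hsR | hsR
  · rw [probGt_zero h x s R hsR]; positivity
  rcases hR.eq_or_lt with hR0 | hR0
  · refine (probGt_le_one h x s R).trans ?_
    rw [← hR0, Real.zero_rpow (by linarith), zero_div, Real.zero_rpow (by
      have : 0 < θ - 1 := by linarith
      positivity), mul_zero, neg_zero, Real.exp_zero, mul_one, le_div_iff₀ hm0]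
    linarith
  obtain ⟨r, hr, j, hj, hb⟩ := hc R hR0 s hsR.le
  have hl : 0 < A / r ^ θ := by positivity
  obtain ⟨v, hv⟩ := sol_exists h hl x R
  refine le_trans (probGt_sol h hl x s R hv) (le_trans ?_ hb)
  apply mul_le_mul_of_nonneg_left _ (by positivity)
  refine chain h hl hr hm0.le ?_ hv j x (by simpa using hj)
  intro y u hu
  obtain ⟨i, hi2⟩ := pow_unbounded_of_one_lt r (by norm_num : (1:ℝ) < 4)
  refine core h hθ (le_max_right CD 2) hVD2 hC2 hCS hCP hPI hm0 hm1.le hmp hA hCs hi hii i r hr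
    ?_ y u hu
  have h16 : (1:ℝ) ≤ 16 * ((n:ℝ) + 1) := by
    have : (0:ℝ) ≤ n := Nat.cast_nonneg n
    linarith
  have h4 : (0:ℝ) < 4 ^ i := by positivity
  nlinarith
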